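/- arXiv:2603.10589 — 6 statements merged into one kernel-verified Lean document; each statement's English description precedes it below -/
import Mathlib

section
/- There exists a bijection c : ℕ ≃ ℕ such that c ∘ S ∘ c⁻¹ is primitive recursive (where S x = x + 1), every function f belonging to the class 𝓛_c has primitive recursive conjugate c ∘ f ∘ c⁻¹, and yet the conjugate of the predecessor function, c ∘ Pred ∘ c⁻¹ (where Pred 0 = 0 and Pred (n+1) = n), is not primitive recursive. (Hence the class 𝓛_c is not a basis for punctual standardness.) -/
/-- The class 𝓛_c: the least class of functions containing the constants `0`, `1`
and the identity, closed under pointwise addition, pointwise multiplication, and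
`x ↦ n ^ f x` for positive `n`. -/
inductive LevitzC : (ℕ → ℕ) → Prop
  | zero : LevitzC fun _ => 0
  | one : LevitzC fun _ => 1
  | id : LevitzC fun x => x
  | add {f g : ℕ → ℕ} : LevitzC f → LevitzC g → LevitzC fun x => f x + g x
  | mul {f g : ℕ → ℕ} : LevitzC f → LevitzC g → LevitzC fun x => f x * g x
  | exp {f : ℕ → ℕ} (n : ℕ) : 0 < n → LevitzC f → LevitzC fun x => n ^ f x


/-- Real functions which are polynomials of degree at most `d` in `x` and in each of the
exponentials `exp ∘ u 0, …, exp ∘ u (i - 1)`. -/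
def expPoly (u : ℕ → ℝ → ℝ) : ℕ → ℕ → Set (ℝ → ℝ)
  | 0, d => {f | ∃ p : Polynomial ℝ, p.natDegree ≤ d ∧ f = fun x => p.eval x}
  | i + 1, d => {f | ∃ a : ℕ → ℝ → ℝ, (∀ j, a j ∈ expPoly u i d) ∧
      f = fun x => ∑ j ∈ Finset.range (d + 1), a j x * Real.exp (j * u i x)}

namespace expPoly

variable {u : ℕ → ℝ → ℝ} {i d e : ℕ} {f g : ℝ → ℝ}

theorem zero_mem (i d : ℕ) : (fun _ => 0) ∈ expPoly u i d := by
  induction i with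
  | zero => exact ⟨0, by simp, by simp⟩
  | succ i ih => exact ⟨fun _ _ => 0, fun _ => ih, by simp⟩

theorem add_mem (hf : f ∈ expPoly u i d) (hg : g ∈ expPoly u i d) :
    (fun x => f x + g x) ∈ expPoly u i d := by
  induction i generalizing f g with
  | zero =>
    obtain ⟨p, hp, rfl⟩ := hf
    obtain ⟨q, hq, rfl⟩ := hg
    exact ⟨p + q, Polynomial.natDegree_add_le_of_degree_le hp hq, by simp⟩
  | succ i ih =>
    obtain ⟨a, ha, rfl⟩ := hf
    obtain ⟨b, hb, rfl⟩ := hg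
    exact ⟨fun j x => a j x + b j x, fun j => ih (ha j) (hb j), by
      simp [add_mul, Finset.sum_add_distrib]⟩

theorem sum_mem {s : Finset ℕ} {F : ℕ → ℝ → ℝ} (h : ∀ j ∈ s, F j ∈ expPoly u i d) :
    (fun x => ∑ j ∈ s, F j x) ∈ expPoly u i d := by
  induction s using Finset.cons_induction with
  | empty => simpa using zero_mem i d
  | cons j s hj ih =>
    simp only [Finset.sum_cons]
    exact add_mem (h j (by simp)) (ih fun k hk => h k (by simp [hk]))

theorem mul_exp_mem {j : ℕ} (hf : f ∈ expPoly u i d) (hj : j ≤ d) :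
    (fun x => f x * Real.exp (j * u i x)) ∈ expPoly u (i + 1) d := by
  refine ⟨fun k x => if k = j then f x else 0, fun k => ?_, ?_⟩
  · by_cases h : k = j
    · simpa [h] using hf
    · simpa [h] using zero_mem i d
  · ext x
    simp [ite_mul, hj]

theorem mono (hf : f ∈ expPoly u i d) (h : d ≤ e) : f ∈ expPoly u i e := by
  induction i generalizing f with
  | zero =>
    obtain ⟨p, hp, rfl⟩ := hf
    exact ⟨p, hp.trans h, rfl⟩
  | succ i ih =>
    obtain ⟨a, ha, rfl⟩ := hf
    exact sum_mem fun j hj => mul_exp_mem (ih (ha j)) (by simp at hj; omega)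

theorem mem_succ (hf : f ∈ expPoly u i d) : f ∈ expPoly u (i + 1) d := by
  simpa using mul_exp_mem (j := 0) hf (Nat.zero_le d)

theorem mono_left {k : ℕ} (hf : f ∈ expPoly u i d) (h : i ≤ k) : f ∈ expPoly u k d := by
  induction h with
  | refl => exact hf
  | step _ ih => exact mem_succ ih

theorem const_mem (c : ℝ) : (fun _ => c) ∈ expPoly u i d :=
  mono_left (i := 0) ⟨Polynomial.C c, by simp, by simp⟩ (Nat.zero_le i)

theorem id_mem : (fun x => x) ∈ expPoly u i (d + 1) :=
  mono_left (i := 0) ⟨Polynomial.X, by simp, by simp⟩ (Nat.zero_le i)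

theorem mul_mem (hf : f ∈ expPoly u i d) (hg : g ∈ expPoly u i e) :
    (fun x => f x * g x) ∈ expPoly u i (d + e) := by
  induction i generalizing f g with
  | zero =>
    obtain ⟨p, hp, rfl⟩ := hf
    obtain ⟨q, hq, rfl⟩ := hg
    exact ⟨p * q, Polynomial.natDegree_mul_le_of_le hp hq, by simp⟩
  | succ i ih =>
    obtain ⟨a, ha, rfl⟩ := hf
    obtain ⟨b, hb, rfl⟩ := hg
    simp only [Finset.sum_mul_sum]
    refine sum_mem fun j hj => sum_mem fun k hk => ?_
    simp only [Finset.mem_range] at hj hk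
    convert mul_exp_mem (j := j + k) (ih (ha j) (hb k)) (by omega) using 2 with x
    push_cast
    rw [add_mul, Real.exp_add]
    ring

theorem const_mul_mem (c : ℝ) (hf : f ∈ expPoly u i d) : (fun x => c * f x) ∈ expPoly u i d := by
  simpa using mul_mem (const_mem (d := 0) c) hf

theorem sub_mem (hf : f ∈ expPoly u i d) (hg : g ∈ expPoly u i d) :
    (fun x => f x - g x) ∈ expPoly u i d := by
  simpa [sub_eq_add_neg] using add_mem hf (const_mul_mem (-1) hg)

theorem analyticOnNhd (hu : ∀ i, u i ∈ expPoly u i (2 ^ i)) (hf : f ∈ expPoly u i d) :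
    AnalyticOnNhd ℝ f Set.univ := by
  induction i generalizing f d with
  | zero =>
    obtain ⟨p, hp, rfl⟩ := hf
    exact AnalyticOnNhd.eval_polynomial p
  | succ i ih =>
    obtain ⟨a, ha, rfl⟩ := hf
    refine Finset.analyticOnNhd_fun_sum _ fun j _ => ?_
    exact (ih (ha j)).mul ((analyticOnNhd_const.mul (ih (hu i))).rexp)

theorem differentiable (hu : ∀ i, u i ∈ expPoly u i (2 ^ i)) (hf : f ∈ expPoly u i d) :
    Differentiable ℝ f :=
  fun x => (analyticOnNhd hu hf x trivial).differentiableAt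

theorem hasDerivAt_sum_exp {a : ℕ → ℝ → ℝ} {v : ℝ → ℝ} (ha : ∀ j, Differentiable ℝ (a j))
    (hv : Differentiable ℝ v) (s : Finset ℕ) (x : ℝ) :
    HasDerivAt (fun x => ∑ j ∈ s, a j x * Real.exp (j * v x))
      (∑ j ∈ s, (deriv (a j) x + j * (a j x * deriv v x)) * Real.exp (j * v x)) x := by
  refine HasDerivAt.fun_sum fun j _ => ?_
  refine ((ha j x).hasDerivAt.fun_mul (((hv x).hasDerivAt.const_mul (j : ℝ)).exp)).congr_deriv ?_
  ring

theorem deriv_mem (hu : ∀ i, u i ∈ expPoly u i (2 ^ i)) (hf : f ∈ expPoly u i d) :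
    deriv f ∈ expPoly u i (d + 2 ^ i) := by
  induction i generalizing f d with
  | zero =>
    obtain ⟨p, hp, rfl⟩ := hf
    refine ⟨Polynomial.derivative p, ?_, ?_⟩
    · exact (Polynomial.natDegree_derivative_le p).trans (by omega)
    · ext x
      simp
  | succ i ih =>
    obtain ⟨a, ha, rfl⟩ := hf
    have hd : ∀ x, _ := hasDerivAt_sum_exp (fun j => differentiable hu (ha j))
      (differentiable hu (hu i)) (Finset.range (d + 1))
    rw [show deriv _ = _ from funext fun x => (hd x).deriv]
    refine sum_mem fun j hj => mul_exp_mem (add_mem ?_ (const_mul_mem j ?_)) ?_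
    · exact mono (ih (ha j)) (by rw [pow_succ]; omega)
    · exact mono (mul_mem (ha j) (ih (hu i))) (by rw [pow_succ]; omega)
    · exact (Finset.mem_range_succ_iff.1 hj).trans (Nat.le_add_right d _)

end expPoly

/-- If `f' a - f a'` and `a` have few zeros, then so does `f`. -/
theorem encard_zeros_le_of_wronskian {f a : ℝ → ℝ} {A B : ℕ} (hf : Differentiable ℝ f)
    (ha : Differentiable ℝ a) (hA : {x | a x = 0}.encard ≤ A)
    (hB : {x | deriv f x * a x - f x * deriv a x = 0}.encard ≤ B) :
    {x | f x = 0}.encard ≤ (2 * A + B + 1 : ℕ) := by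
  classical
  have hAf : {x | a x = 0}.Finite := Set.finite_of_encard_le_coe hA
  have hBf : {x | deriv f x * a x - f x * deriv a x = 0}.Finite := Set.finite_of_encard_le_coe hB
  have hA' : hAf.toFinset.card ≤ A := by
    rw [hAf.encard_eq_coe_toFinset_card] at hA
    exact_mod_cast hA
  have hB' : hBf.toFinset.card ≤ B := by
    rw [hBf.encard_eq_coe_toFinset_card] at hB
    exact_mod_cast hB
  have key : ∀ s : Finset ℝ, (∀ x ∈ s, f x = 0) → s.card ≤ 2 * A + B + 1 := by
    intro s hs
    have h1 : (s \ hAf.toFinset).card ≤ (hAf.toFinset ∪ hBf.toFinset).card + 1 := by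
      refine Finset.card_le_of_interleaved fun x hx y hy hxy _ => ?_
      simp only [Finset.mem_sdiff, Set.Finite.mem_toFinset, Set.mem_ofPred_eq] at hx hy
      by_cases h : ∃ z ∈ Set.Ioo x y, a z = 0
      · obtain ⟨z, hz, h⟩ := h
        exact ⟨z, by simp [h], hz.1, hz.2⟩
      push Not at h
      have hne : ∀ z ∈ Set.Icc x y, a z ≠ 0 := by
        intro z hz
        rcases hz.1.eq_or_lt with rfl | h1
        · exact hx.2
        rcases hz.2.eq_or_lt with rfl | h2
        · exact hy.2
        exact h z ⟨h1, h2⟩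
      obtain ⟨z, hz, h0⟩ := exists_hasDerivAt_eq_zero (f := fun x => f x / a x) hxy
        (hf.continuous.continuousOn.div ha.continuous.continuousOn hne)
        (by simp [hs x hx.1, hs y hy.1])
        fun z hz => (hf z).hasDerivAt.div (ha z).hasDerivAt (h z hz)
      refine ⟨z, ?_, hz.1, hz.2⟩
      rw [div_eq_zero_iff, or_iff_left (pow_ne_zero 2 (h z hz))] at h0
      simp [h0]
    have h2 := Finset.card_union_le hAf.toFinset hBf.toFinset
    have h3 : s.card ≤ (s \ hAf.toFinset).card + hAf.toFinset.card := by
      rw [add_comm]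
      exact tsub_le_iff_left.1 (Finset.le_card_sdiff _ _)
    omega
  by_contra! hlt
  by_cases hfin : {x | f x = 0}.Finite
  · rw [hfin.encard_eq_coe_toFinset_card, Nat.cast_lt] at hlt
    exact absurd (key hfin.toFinset fun x hx => by simpa using hx) hlt.not_ge
  · obtain ⟨t, hts, htc⟩ := Set.Infinite.exists_subset_card_eq hfin (2 * A + B + 2)
    have := key t fun x hx => hts hx
    omega

/-- If the Wronskian of two analytic functions vanishes, then every zero of the first one
is a zero of the second, unless the first one vanishes identically. -/
theorem eq_zero_of_wronskian_eq_zero {f a : ℝ → ℝ} (hf : AnalyticOnNhd ℝ f Set.univ)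
    (ha : Differentiable ℝ a) (h : ∀ x, deriv f x * a x - f x * deriv a x = 0) {z : ℝ}
    (hfz : f z = 0) (haz : a z ≠ 0) : f = 0 := by
  have hfd : Differentiable ℝ f := fun x => (hf x trivial).differentiableAt
  obtain ⟨ε, hε, hball⟩ := Metric.eventually_nhds_iff_ball.1
    (ha.continuous.continuousAt.eventually_ne haz)
  have hd : ∀ x ∈ Metric.ball z ε, HasDerivAt (fun x => f x / a x) 0 x := fun x hx => by
    simpa [h x] using (hfd x).hasDerivAt.fun_div (ha x).hasDerivAt (hball x hx)
  refine hf.eq_of_eventuallyEq (z₀ := z) analyticOnNhd_const ?_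
  filter_upwards [Metric.ball_mem_nhds z hε] with x hx
  have hc := (convex_ball z ε).is_const_of_fderivWithin_eq_zero (𝕜 := ℝ)
    (fun y hy => (hd y hy).differentiableAt.differentiableWithinAt)
    (fun y hy => by
      rw [fderivWithin_of_isOpen Metric.isOpen_ball hy]
      ext
      simp [(hd y hy).deriv]) hx (Metric.mem_ball_self hε)
  simp only [hfz, zero_div, div_eq_zero_iff] at hc
  exact hc.resolve_right (hball x hx)

/-- One step of the recursion bounding the number of zeros of functions in `expPoly`. -/
def zeroStep (d : ℕ) : ℕ := d * 3 ^ (2 * d + 2)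

theorem zeroStep_mono : Monotone zeroStep := fun a b h => by
  unfold zeroStep
  gcongr
  norm_num

theorem mul_iterate_zeroStep_le {c : ℕ} (hc : 1 ≤ c) (i d : ℕ) :
    c * zeroStep^[i] d ≤ zeroStep^[i] (c * d) := by
  induction i generalizing d with
  | zero => simp
  | succ i ih =>
    simp only [Function.iterate_succ, Function.comp_apply]
    refine (ih _).trans (zeroStep_mono.iterate i ?_)
    unfold zeroStep
    rw [mul_assoc]
    gcongr
    · norm_num
    · exact Nat.le_mul_of_pos_left d hc

theorem le_iterate_zeroStep (i d : ℕ) : d ≤ zeroStep^[i] d := by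
  induction i with
  | zero => simp
  | succ i ih =>
    rw [Function.iterate_succ_apply']
    exact ih.trans (Nat.le_mul_of_pos_right _ (by positivity))

namespace expPoly

variable {u : ℕ → ℝ → ℝ}

theorem encard_zeros_sum_le (hu : ∀ i, u i ∈ expPoly u i (2 ^ i)) {i : ℕ} {Z : ℕ → ℕ}
    (hZ : Monotone Z)
    (ih : ∀ d f, 2 ^ i ≤ d → f ∈ expPoly u i d → f = 0 ∨ {x | f x = 0}.encard ≤ Z d)
    (n : ℕ) {e : ℕ} (he : 2 ^ (i + 1) ≤ e) {a : ℕ → ℝ → ℝ} (ha : ∀ j, a j ∈ expPoly u i e)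
    {f : ℝ → ℝ} (hf : f = fun x => ∑ j ∈ Finset.range n, a j x * Real.exp (j * u i x)) :
    f = 0 ∨ {x | f x = 0}.encard ≤ (n * (2 * Z (3 ^ n * e) + 1) : ℕ) := by
  induction n generalizing e a f with
  | zero => exact Or.inl (by simp [hf]; rfl)
  | succ n ihn =>
    have hi : 2 ^ (i + 1) = 2 * 2 ^ i := pow_succ' 2 i
    have hZe : Z e ≤ Z (3 ^ (n + 1) * e) := hZ (Nat.le_mul_of_pos_left e (by positivity))
    have hZn : Z (3 ^ n * e) ≤ Z (3 ^ (n + 1) * e) :=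
      hZ (Nat.mul_le_mul_right e (Nat.pow_le_pow_right (by norm_num) (by omega)))
    have hfa : AnalyticOnNhd ℝ f Set.univ := by
      rw [hf]
      refine Finset.analyticOnNhd_fun_sum _ fun j _ => ?_
      exact (analyticOnNhd hu (ha j)).mul
        ((analyticOnNhd_const.mul (analyticOnNhd hu (hu i))).rexp)
    have hda := fun j => differentiable hu (ha j)
    have key : ∀ c : ℕ → ℝ → ℝ, ∀ x, ∑ j ∈ Finset.range n, c j x *
        Real.exp ((j + 1 : ℕ) * u i x) =
        Real.exp (u i x) * ∑ j ∈ Finset.range n, c j x * Real.exp (j * u i x) := by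
      intro c x
      rw [Finset.mul_sum]
      refine Finset.sum_congr rfl fun j _ => ?_
      push_cast
      rw [add_mul, Real.exp_add, one_mul]
      ring
    have hf' : ∀ x, f x = a 0 x + Real.exp (u i x) *
        ∑ j ∈ Finset.range n, a (j + 1) x * Real.exp (j * u i x) := by
      intro x
      rw [hf, ← key fun j => a (j + 1)]
      simp only [Finset.sum_range_succ']
      simp [add_comm]
    rcases ih e (a 0) (by omega) (ha 0) with h0 | h0
    · have hz : ∀ x, f x = 0 ↔
          ∑ j ∈ Finset.range n, a (j + 1) x * Real.exp (j * u i x) = 0 := by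
        intro x
        simp [hf' x, h0, Real.exp_ne_zero]
      rcases ihn he (fun j => ha (j + 1)) rfl with h | h
      · exact Or.inl (funext fun x => (hz x).2 (congrFun h x))
      · right
        simp only [hz]
        refine h.trans ?_
        norm_cast
        gcongr
        omega
    · set b : ℕ → ℝ → ℝ := fun j x =>
        (deriv (a (j + 1)) x + (j + 1 : ℕ) * (a (j + 1) x * deriv (u i) x)) * a 0 x -
          a (j + 1) x * deriv (a 0) x with hb
      have hbm : ∀ j, b j ∈ expPoly u i (3 * e) := fun j =>
        sub_mem
          (mono (mul_mem (add_mem (mono (deriv_mem hu (ha _)) (by omega))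
            (const_mul_mem _ (mul_mem (ha _) (deriv_mem hu (hu i))))) (ha 0)) (by omega))
          (mono (mul_mem (ha _) (deriv_mem hu (ha 0))) (by omega))
      have hw : ∀ x, deriv f x * a 0 x - f x * deriv (a 0) x =
          Real.exp (u i x) * ∑ j ∈ Finset.range n, b j x * Real.exp (j * u i x) := by
        intro x
        rw [← key b, hf, (hasDerivAt_sum_exp hda (differentiable hu (hu i)) _ x).deriv]
        simp only [Finset.sum_range_succ', Nat.cast_zero, zero_mul, add_zero, Real.exp_zero,
          mul_one]
        have : ∀ p q r s : ℝ, (p + q) * r - (s + r) * q = p * r - s * q := by intros; ring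
        rw [this, Finset.sum_mul, Finset.sum_mul, ← Finset.sum_sub_distrib]
        refine Finset.sum_congr rfl fun j _ => ?_
        simp only [hb]
        ring
      rcases ihn (e := 3 * e) (by omega) hbm rfl with h | h
      · by_cases hf0 : f = 0
        · exact Or.inl hf0
        · right
          refine (Set.encard_le_encard fun x hx => ?_).trans (h0.trans ?_)
          · by_contra hax
            refine hf0 (eq_zero_of_wronskian_eq_zero hfa (hda 0) (fun y => ?_) hx hax)
            rw [hw, show ∑ j ∈ Finset.range n, b j y * Real.exp (j * u i y) = 0 from
              congrFun h y, mul_zero]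
          · norm_cast
            nlinarith
      · right
        have := encard_zeros_le_of_wronskian (f := f) (a := a 0)
          (fun x => (hfa x trivial).differentiableAt) (hda 0) h0
          (B := n * (2 * Z (3 ^ n * (3 * e)) + 1)) (by
            simpa only [hw, mul_eq_zero, Real.exp_ne_zero, false_or] using h)
        refine this.trans ?_
        norm_cast
        rw [show 3 ^ n * (3 * e) = 3 ^ (n + 1) * e by ring]
        nlinarith

theorem encard_zeros_le (hu : ∀ i, u i ∈ expPoly u i (2 ^ i)) {i d : ℕ} {f : ℝ → ℝ}
    (hd : 2 ^ i ≤ d) (hf : f ∈ expPoly u i d) :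
    f = 0 ∨ {x | f x = 0}.encard ≤ zeroStep^[i] d := by
  induction i generalizing d f with
  | zero =>
    obtain ⟨p, hp, rfl⟩ := hf
    by_cases h : p = 0
    · exact Or.inl (by ext; simp [h])
    · right
      have : {x | p.eval x = 0} = (p.roots.toFinset : Set ℝ) := by
        ext x
        simp [h]
      rw [this, Set.encard_coe_eq_coe_finsetCard]
      norm_cast
      exact (Multiset.toFinset_card_le _).trans ((Polynomial.card_roots' p).trans hp)
  | succ i ih =>
    obtain ⟨a, ha, hf⟩ := hf
    refine (encard_zeros_sum_le hu (zeroStep_mono.iterate i) (fun d f => ih) (d + 1) hd ha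
      hf).imp_right fun h => h.trans ?_
    norm_cast
    have hd1 : 1 ≤ d := le_trans Nat.one_le_two_pow hd
    have h1 := le_iterate_zeroStep i (3 ^ (d + 1) * d)
    have h2 : 1 ≤ 3 ^ (d + 1) * d := Nat.one_le_iff_ne_zero.2 (by positivity)
    rw [Function.iterate_succ_apply]
    calc (d + 1) * (2 * zeroStep^[i] (3 ^ (d + 1) * d) + 1)
        ≤ (3 * (d + 1)) * zeroStep^[i] (3 ^ (d + 1) * d) := by nlinarith
      _ ≤ zeroStep^[i] (3 * (d + 1) * (3 ^ (d + 1) * d)) := mul_iterate_zeroStep_le (by omega) _ _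
      _ ≤ zeroStep^[i] (zeroStep d) := by
        refine zeroStep_mono.iterate i ?_
        have h3 : d + 1 ≤ 3 ^ d := Nat.lt_pow_self (by norm_num)
        calc 3 * (d + 1) * (3 ^ (d + 1) * d) ≤ 3 * 3 ^ d * (3 ^ (d + 1) * d) := by gcongr
          _ = zeroStep d := by
            unfold zeroStep
            ring

end expPoly

/-- The value of a node of a term: tags `0`, `1`, `2` stand for constants, sums and products,
all others for exponentials. -/
def nodeVal (tag b p q : ℕ) : ℕ :=
  if tag = 0 then b else if tag = 1 then p + q else if tag = 2 then p * q else (b + 1) ^ p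

theorem unpair_unpair_fst_lt (n : ℕ) : n.unpair.2.unpair.1 < n + 1 :=
  Nat.lt_succ_of_le ((Nat.unpair_left_le _).trans (Nat.unpair_right_le _))

theorem unpair_unpair_snd_lt (n : ℕ) : n.unpair.2.unpair.2 < n + 1 :=
  Nat.lt_succ_of_le ((Nat.unpair_right_le _).trans (Nat.unpair_right_le _))

/-- The function denoted by the term with a given code; the code `0` stands for the variable. -/
def termVal : ℕ → ℕ → ℕ
  | 0, x => x
  | n + 1, x =>
    have := unpair_unpair_fst_lt n
    have := unpair_unpair_snd_lt n
    nodeVal n.unpair.1 n.unpair.2.unpair.2 (termVal n.unpair.2.unpair.1 x)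
      (termVal n.unpair.2.unpair.2 x)

/-- The code of the term with given tag and arguments. -/
def node (tag a b : ℕ) : ℕ := Nat.pair tag (Nat.pair a b) + 1

theorem termVal_zero (x : ℕ) : termVal 0 x = x := by rw [termVal]

theorem termVal_succ (n x : ℕ) : termVal (n + 1) x =
    nodeVal n.unpair.1 n.unpair.2.unpair.2 (termVal n.unpair.2.unpair.1 x)
      (termVal n.unpair.2.unpair.2 x) := by rw [termVal]

theorem termVal_node (tag a b x : ℕ) :
    termVal (node tag a b) x = nodeVal tag b (termVal a x) (termVal b x) := by
  simp [node, termVal_succ]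

theorem node_cases {P : ℕ → Prop} (var : P 0)
    (node : ∀ tag a b, a < node tag a b → b < node tag a b → P a → P b → P (node tag a b))
    (i : ℕ) : P i := by
  induction i using Nat.strong_induction_on with
  | _ i ih =>
    rcases i with _ | n
    · exact var
    · have h : _root_.node n.unpair.1 n.unpair.2.unpair.1 n.unpair.2.unpair.2 = n + 1 := by
        simp [_root_.node]
      rw [← h]
      exact node _ _ _ (h ▸ unpair_unpair_fst_lt n) (h ▸ unpair_unpair_snd_lt n)
        (ih _ (unpair_unpair_fst_lt n)) (ih _ (unpair_unpair_snd_lt n))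

theorem Primrec.nat_pow : Primrec₂ ((· ^ ·) : ℕ → ℕ → ℕ) :=
  Primrec₂.unpaired'.1 Nat.Primrec.pow

theorem Primrec.nodeVal {α : Type*} [Primcodable α] {t b p q : α → ℕ} (ht : Primrec t)
    (hb : Primrec b) (hp : Primrec p) (hq : Primrec q) :
    Primrec fun x => nodeVal (t x) (b x) (p x) (q x) := by
  unfold _root_.nodeVal
  refine Primrec.ite (Primrec.eq.comp ht (Primrec.const 0)) hb ?_
  refine Primrec.ite (Primrec.eq.comp ht (Primrec.const 1)) (Primrec.nat_add.comp hp hq) ?_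
  refine Primrec.ite (Primrec.eq.comp ht (Primrec.const 2)) (Primrec.nat_mul.comp hp hq) ?_
  exact Primrec.nat_pow.comp (Primrec.succ.comp hb) hp

theorem Primrec.termVal : Primrec₂ termVal := by
  have h1 : Primrec fun n : ℕ => n.unpair.1 := Primrec.fst.comp Primrec.unpair
  have h2 : Primrec fun n : ℕ => n.unpair.2 := Primrec.snd.comp Primrec.unpair
  have hp : Primrec₂ fun (p : ℕ × List ℕ) (n : ℕ) => p.2.getD n 0 :=
    (Primrec.list_getD 0).comp₂ (Primrec.snd.comp₂ Primrec₂.left) Primrec₂.right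
  refine Primrec₂.swap (Primrec.nat_strong_rec (fun x i => _root_.termVal i x)
    (g := fun x l => some (l.length.casesOn x fun n => _root_.nodeVal n.unpair.1
      n.unpair.2.unpair.2 (l.getD n.unpair.2.unpair.1 0) (l.getD n.unpair.2.unpair.2 0))) ?_ ?_)
  · refine Primrec.option_some.comp (Primrec.nat_casesOn
      (Primrec.list_length.comp Primrec.snd) Primrec.fst ?_)
    have hs : Primrec fun p : (ℕ × List ℕ) × ℕ => p.2 := Primrec.snd
    refine Primrec.nodeVal (h1.comp hs) (h2.comp (h2.comp hs)) ?_ ?_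
    · exact hp.comp Primrec.fst (h1.comp (h2.comp hs))
    · exact hp.comp Primrec.fst (h2.comp (h2.comp hs))
  · intro x n
    cases n with
    | zero => simp [termVal_zero]
    | succ n =>
      have := unpair_unpair_fst_lt n
      have := unpair_unpair_snd_lt n
      simp [termVal_succ, List.getD, *]

/-- A term is constant or dominates the identity and increases between `1` and `2`. -/
theorem termVal_const_or_le (i : ℕ) : (∀ x, termVal i x = termVal i 0) ∨
    (∀ x, x ≤ termVal i x) ∧ termVal i 1 < termVal i 2 := by
  induction i using node_cases with
  | var => simp [termVal_zero]
  | node tag a b _ _ iha ihb =>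
    simp only [termVal_node, nodeVal]
    split_ifs
    · simp
    · rcases iha with ha | ⟨ha, ha'⟩ <;> rcases ihb with hb | ⟨hb, hb'⟩
      · exact Or.inl fun x => by rw [ha, hb]
      · exact Or.inr ⟨fun x => (hb x).trans (Nat.le_add_left _ _), by
          have := ha 1; have := ha 2; omega⟩
      · exact Or.inr ⟨fun x => (ha x).trans (Nat.le_add_right _ _), by
          have := hb 1; have := hb 2; omega⟩
      · exact Or.inr ⟨fun x => (ha x).trans (Nat.le_add_right _ _), by omega⟩
    · rcases iha with ha | ⟨ha, ha'⟩ <;> rcases ihb with hb | ⟨hb, hb'⟩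
      · exact Or.inl fun x => by rw [ha, hb]
      · rcases Nat.eq_zero_or_pos (termVal a 0) with h0 | h0
        · exact Or.inl fun x => by rw [ha, h0]; simp
        · refine Or.inr ⟨fun x => ?_, ?_⟩
          · rw [ha]
            exact (hb x).trans (Nat.le_mul_of_pos_left _ h0)
          · rw [ha, ha 2]
            gcongr
      · rcases Nat.eq_zero_or_pos (termVal b 0) with h0 | h0
        · exact Or.inl fun x => by rw [hb, h0]; simp
        · refine Or.inr ⟨fun x => ?_, ?_⟩
          · rw [hb]
            exact (ha x).trans (Nat.le_mul_of_pos_right _ h0)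
          · rw [hb, hb 2]
            gcongr
      · exact Or.inr ⟨fun x => (Nat.le_mul_self x).trans (Nat.mul_le_mul (ha x) (hb x)),
          Nat.mul_lt_mul'' ha' hb'⟩
    · rcases iha with ha | ⟨ha, ha'⟩
      · exact Or.inl fun x => by rw [ha]
      · rcases Nat.eq_zero_or_pos b with rfl | hb
        · simp
        · exact Or.inr ⟨fun x => (ha x).trans (Nat.lt_pow_self (by omega)).le,
            Nat.pow_lt_pow_right (by omega) ha'⟩

/-- Composition with a function of the class acts primitive recursively on codes of terms. -/
theorem LevitzC.exists_term_comp {f : ℕ → ℕ} (hf : LevitzC f) :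
    ∃ φ : ℕ → ℕ, Primrec φ ∧ ∀ i x, termVal (φ i) x = f (termVal i x) := by
  have hnode : Primrec fun p : ℕ × ℕ × ℕ => node p.1 p.2.1 p.2.2 :=
    Primrec.succ.comp (Primrec₂.natPair.comp Primrec.fst (Primrec₂.natPair.comp
      (Primrec.fst.comp Primrec.snd) (Primrec.snd.comp Primrec.snd)))
  induction hf with
  | zero => exact ⟨fun _ => node 0 0 0, Primrec.const _, by simp [termVal_node, nodeVal]⟩
  | one => exact ⟨fun _ => node 0 0 1, Primrec.const _, by simp [termVal_node, nodeVal]⟩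
  | id => exact ⟨fun i => i, Primrec.id, by simp⟩
  | add _ _ ihf ihg =>
    obtain ⟨φ, hφ, hφ'⟩ := ihf
    obtain ⟨ψ, hψ, hψ'⟩ := ihg
    exact ⟨fun i => node 1 (φ i) (ψ i), hnode.comp ((Primrec.const 1).pair (hφ.pair hψ)),
      by simp [termVal_node, nodeVal, hφ', hψ']⟩
  | mul _ _ ihf ihg =>
    obtain ⟨φ, hφ, hφ'⟩ := ihf
    obtain ⟨ψ, hψ, hψ'⟩ := ihg
    exact ⟨fun i => node 2 (φ i) (ψ i), hnode.comp ((Primrec.const 2).pair (hφ.pair hψ)),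
      by simp [termVal_node, nodeVal, hφ', hψ']⟩
  | exp n hn _ ihf =>
    obtain ⟨φ, hφ, hφ'⟩ := ihf
    exact ⟨fun i => node 3 (φ i) (n - 1),
      hnode.comp ((Primrec.const 3).pair (hφ.pair (Primrec.const (n - 1)))),
      by simp [termVal_node, nodeVal, hφ', Nat.sub_add_cancel hn]⟩

theorem LevitzC.primrec {f : ℕ → ℕ} (hf : LevitzC f) : Primrec f := by
  obtain ⟨φ, -, hφ⟩ := hf.exists_term_comp
  exact (Primrec.termVal.comp (Primrec.const (φ 0)) Primrec.id).of_eq fun x => by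
    simp [hφ, termVal_zero]

/-- The extension of `termVal` to the reals. -/
noncomputable def termExt : ℕ → ℝ → ℝ
  | 0, x => x
  | n + 1, x =>
    have := unpair_unpair_fst_lt n
    have := unpair_unpair_snd_lt n
    let b := n.unpair.2.unpair.2
    let p := termExt n.unpair.2.unpair.1 x
    if n.unpair.1 = 0 then b
    else if n.unpair.1 = 1 then p + termExt b x
    else if n.unpair.1 = 2 then p * termExt b x
    else Real.exp (Real.log (b + 1) * p)

/-- The function whose exponential is the term with the given code, if this is an exponential. -/
noncomputable def termExponent : ℕ → ℝ → ℝ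
  | 0, _ => 0
  | n + 1, x => Real.log (n.unpair.2.unpair.2 + 1) * termExt n.unpair.2.unpair.1 x

theorem termExt_zero : termExt 0 = fun x => x := by ext; rw [termExt]

theorem termExt_succ (n : ℕ) : termExt (n + 1) =
    if n.unpair.1 = 0 then fun _ => (n.unpair.2.unpair.2 : ℝ)
    else if n.unpair.1 = 1 then
      fun x => termExt n.unpair.2.unpair.1 x + termExt n.unpair.2.unpair.2 x
    else if n.unpair.1 = 2 then
      fun x => termExt n.unpair.2.unpair.1 x * termExt n.unpair.2.unpair.2 x
    else fun x => Real.exp (termExponent (n + 1) x) := by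
  ext x
  rw [termExt]
  split_ifs <;> rfl

theorem termExt_natCast (i x : ℕ) : termExt i x = termVal i x := by
  induction i using Nat.strong_induction_on with
  | _ i ih =>
    rcases i with _ | n
    · simp [termExt_zero, termVal_zero]
    · have h : ∀ b y : ℕ, Real.exp (Real.log (b + 1) * y) = ((b + 1) ^ y : ℕ) := fun b y => by
        rw [mul_comm, Real.exp_nat_mul, Real.exp_log (by positivity)]
        push_cast
        rfl
      rw [termExt_succ, termVal_succ, nodeVal]
      have ha := ih _ (unpair_unpair_fst_lt n)
      have hb := ih _ (unpair_unpair_snd_lt n)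
      split_ifs
      · rfl
      · simp [ha, hb]
      · simp [ha, hb]
      · simp only [termExponent, ha, h]

theorem termExt_mem (i : ℕ) : termExt i ∈ expPoly termExponent (i + 1) (2 ^ i) := by
  induction i using Nat.strong_induction_on with
  | _ i ih =>
    rcases i with _ | n
    · rw [termExt_zero]
      exact expPoly.id_mem
    · have h : ∀ k < n + 1, termExt k ∈ expPoly termExponent (n + 1 + 1) (2 ^ n) := fun k hk =>
        expPoly.mono (expPoly.mono_left (ih k hk) (by omega))
          (Nat.pow_le_pow_right (by norm_num) (by omega))
      have ha := h _ (unpair_unpair_fst_lt n)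
      have hb := h _ (unpair_unpair_snd_lt n)
      rw [termExt_succ]
      split_ifs
      · exact expPoly.const_mem _
      · exact expPoly.mono (expPoly.add_mem ha hb) (Nat.pow_le_pow_right (by norm_num) (by omega))
      · rw [pow_succ, mul_two]
        exact expPoly.mul_mem ha hb
      · simpa using expPoly.mul_exp_mem (u := termExponent) (i := n + 1) (j := 1)
          (expPoly.const_mem 1) Nat.one_le_two_pow

theorem termExponent_mem (i : ℕ) : termExponent i ∈ expPoly termExponent i (2 ^ i) := by
  rcases i with _ | n
  · exact expPoly.const_mem 0
  · have h := unpair_unpair_fst_lt n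
    exact expPoly.const_mul_mem _ (expPoly.mono (expPoly.mono_left (termExt_mem _) (by omega))
      (Nat.pow_le_pow_right (by norm_num) (by omega)))

/-- A bound on the number of points at which two different terms with codes at most `m` agree. -/
def agreeBound (m : ℕ) : ℕ := zeroStep^[m + 1] (2 ^ (m + 1))

theorem Primrec.agreeBound : Primrec agreeBound := by
  have hz : Primrec zeroStep := Primrec.nat_mul.comp Primrec.id
    (Primrec.nat_pow.comp (Primrec.const 3)
      (Primrec.nat_add.comp (Primrec.nat_mul.comp (Primrec.const 2) Primrec.id)
        (Primrec.const 2)))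
  exact Primrec.nat_iterate Primrec.succ (Primrec.nat_pow.comp (Primrec.const 2) Primrec.succ)
    (hz.comp₂ Primrec₂.right)

theorem encard_agree_le {i j m : ℕ} (hi : i ≤ m) (hj : j ≤ m) (hij : termVal i ≠ termVal j) :
    {x | termVal i x = termVal j x}.encard ≤ agreeBound m := by
  have hmem : ∀ k ≤ m, termExt k ∈ expPoly termExponent (m + 1) (2 ^ (m + 1)) := fun k hk =>
    expPoly.mono (expPoly.mono_left (termExt_mem k) (by omega))
      (Nat.pow_le_pow_right (by norm_num) (by omega))
  rcases expPoly.encard_zeros_le termExponent_mem le_rfl (expPoly.sub_mem (hmem i hi) (hmem j hj)) with h | h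
  · refine absurd (funext fun x => ?_) hij
    have := congrFun h x
    simp only [termExt_natCast, Pi.zero_apply, sub_eq_zero] at this
    exact_mod_cast this
  · rw [← Set.InjOn.encard_image (f := ((↑) : ℕ → ℝ)) Nat.cast_injective.injOn]
    refine (Set.encard_le_encard ?_).trans h
    rintro _ ⟨x, hx, rfl⟩
    have hx : termVal i x = termVal j x := hx
    simp [termExt_natCast, hx]

theorem PrimrecRel.forall_lt_left {β : Type*} [Primcodable β] {R : ℕ → β → Prop}
    (hR : PrimrecRel R) : PrimrecRel fun n y => ∀ x < n, R x y :=
  (hR.forall_mem_list.comp (Primrec.list_range.comp Primrec.fst) Primrec.snd).of_eq (by simp)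

theorem primrecRel_termVal_eq : PrimrecRel fun i j => termVal i = termVal j := by
  have hR : PrimrecRel fun (x : ℕ) (p : ℕ × ℕ) => termVal p.1 x = termVal p.2 x :=
    Primrec.eq.comp (Primrec.termVal.comp (Primrec.fst.comp Primrec.snd) Primrec.fst)
      (Primrec.termVal.comp (Primrec.snd.comp Primrec.snd) Primrec.fst)
  refine (hR.forall_lt_left.comp (f := fun p : ℕ × ℕ => agreeBound (p.1 + p.2) + 1)
    (Primrec.succ.comp (Primrec.agreeBound.comp Primrec.nat_add)) Primrec.id).of_eq ?_
  rintro ⟨i, j⟩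
  refine ⟨fun h => ?_, fun h x _ => congrFun h x⟩
  by_contra hij
  have h1 := encard_agree_le (Nat.le_add_right i j) (Nat.le_add_left j i) hij
  have h2 : ((Finset.range (agreeBound (i + j) + 1) : Finset ℕ) : Set ℕ).encard ≤
      {x | termVal i x = termVal j x}.encard :=
    Set.encard_le_encard fun x hx => h x (by simpa using hx)
  rw [Set.encard_coe_eq_coe_finsetCard, Finset.card_range] at h2
  have := h2.trans h1
  norm_cast at this
  omega

theorem exists_separating (m : ℕ) : ∃ N, m ≤ N ∧ N ≤ m + (m + 1) * (m + 1) * agreeBound m ∧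
    ∀ i < m + 1, ∀ j < m + 1, termVal i N = termVal j N → termVal i = termVal j := by
  classical
  by_contra! hcon
  set M := m + (m + 1) * (m + 1) * agreeBound m with hM
  set s := ((Finset.range (m + 1)) ×ˢ (Finset.range (m + 1))).filter
    fun p => termVal p.1 ≠ termVal p.2 with hs
  set B : ℕ × ℕ → Finset ℕ := fun p => (Finset.Icc m M).filter
    fun x => termVal p.1 x = termVal p.2 x with hB
  have hsub : Finset.Icc m M ⊆ s.biUnion B := by
    intro N hN
    obtain ⟨i, hi, j, hj, he, hne⟩ := hcon N (Finset.mem_Icc.1 hN).1 (Finset.mem_Icc.1 hN).2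
    refine Finset.mem_biUnion.2 ⟨(i, j), ?_, ?_⟩
    · simp only [hs, Finset.mem_filter, Finset.mem_product, Finset.mem_range]
      exact ⟨⟨hi, hj⟩, hne⟩
    · exact Finset.mem_filter.2 ⟨hN, he⟩
  have hcard : (s.biUnion B).card ≤ s.card * agreeBound m := by
    refine Finset.card_biUnion_le_card_mul _ _ _ fun p hp => ?_
    simp only [hs, Finset.mem_filter, Finset.mem_product, Finset.mem_range] at hp
    have h1 := encard_agree_le (m := m) (by omega) (by omega) hp.2
    have h2 : ((B p : Finset ℕ) : Set ℕ).encard ≤ {x | termVal p.1 x = termVal p.2 x}.encard :=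
      Set.encard_le_encard fun x hx => (Finset.mem_filter.1 hx).2
    rw [Set.encard_coe_eq_coe_finsetCard] at h2
    exact_mod_cast h2.trans h1
  have hscard : s.card ≤ (m + 1) * (m + 1) :=
    (Finset.card_filter_le _ _).trans (by simp)
  have h1 := Finset.card_le_card hsub
  have h2 := Nat.mul_le_mul_right (agreeBound m) hscard
  rw [Nat.card_Icc] at h1
  omega

/-- There are primitive recursively arbitrarily large points separating small terms. -/
theorem exists_primrec_separating : ∃ G : ℕ → ℕ, Primrec G ∧ (∀ m, m ≤ G m) ∧
    ∀ m, ∀ i ≤ m, ∀ j ≤ m, termVal i (G m) = termVal j (G m) → termVal i = termVal j := by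
  classical
  set good : ℕ → ℕ → Prop := fun m N => ∀ i < m + 1, ∀ j < m + 1,
    termVal i N = termVal j N → termVal i = termVal j with hgood
  have hR : PrimrecRel fun (j : ℕ) (p : ℕ × ℕ × ℕ) =>
      termVal p.1 p.2.2 = termVal j p.2.2 → termVal p.1 = termVal j := by
    have hN : Primrec fun q : ℕ × ℕ × ℕ × ℕ => q.2.2.2 :=
      Primrec.snd.comp (Primrec.snd.comp Primrec.snd)
    have hi : Primrec fun q : ℕ × ℕ × ℕ × ℕ => q.2.1 := Primrec.fst.comp Primrec.snd
    refine ((Primrec.eq.comp (Primrec.termVal.comp hi hN)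
      (Primrec.termVal.comp Primrec.fst hN)).not.or
      (primrecRel_termVal_eq.comp hi Primrec.fst)).of_eq fun q => ?_
    exact imp_iff_not_or.symm
  have hR' : PrimrecRel fun (i : ℕ) (p : ℕ × ℕ) => ∀ j < p.1 + 1,
      termVal i p.2 = termVal j p.2 → termVal i = termVal j :=
    hR.forall_lt_left.comp (Primrec.succ.comp (Primrec.fst.comp Primrec.snd)) Primrec.id
  have hg : PrimrecRel good :=
    hR'.forall_lt_left.comp (Primrec.succ.comp Primrec.fst) Primrec.id
  have hb : Primrec fun m => m + (m + 1) * (m + 1) * agreeBound m :=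
    Primrec.nat_add.comp Primrec.id (Primrec.nat_mul.comp
      (Primrec.nat_mul.comp Primrec.succ Primrec.succ) Primrec.agreeBound)
  refine ⟨_, Primrec.nat_findGreatest hb hg, fun m => ?_, fun m i hi j hj => ?_⟩
  · obtain ⟨N, h1, h2, h3⟩ := exists_separating m
    exact h1.trans (Nat.le_findGreatest h2 h3)
  · obtain ⟨N, h1, h2, h3⟩ := exists_separating m
    exact Nat.findGreatest_spec (P := good m) h2 h3 i (by omega) j (by omega)

/-- A function is honest if its graph can be explored primitive recursively. -/
def Honest (T : ℕ → ℕ) : Prop := Primrec₂ fun k w => min (T k) w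

/-- Some honest function is not bounded by any primitive recursive function. -/
theorem exists_honest_unbounded :
    ∃ T : ℕ → ℕ, Honest T ∧ ∀ b : ℕ → ℕ, Primrec b → ∃ k, b k < T k := by
  classical
  obtain ⟨c, hc⟩ := Nat.Partrec.Code.exists_code.1 (Partrec.nat_iff.1
    (computable₂_ack.comp Computable.id Computable.id : Computable fun k => ack k k).partrec)
  have hev : ∀ k, ack k k ∈ c.eval k := fun k => by rw [hc]; exact Part.mem_some _
  have hex : ∀ k, ∃ t, (c.evaln t k).isSome := fun k => by
    obtain ⟨t, ht⟩ := Nat.Partrec.Code.evaln_complete.1 (hev k)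
    exact ⟨t, by rw [Option.mem_def.1 ht]; rfl⟩
  have hmono : ∀ k t t', t ≤ t' → (c.evaln t k).isSome → (c.evaln t' k).isSome :=
    fun k t t' h h1 => by
      obtain ⟨x, hx⟩ := Option.isSome_iff_exists.1 h1
      rw [Option.mem_def.1 (Nat.Partrec.Code.evaln_mono h hx)]
      rfl
  have hprim : Primrec₂ fun t k : ℕ => c.evaln t k :=
    Nat.Partrec.Code.primrec_evaln.comp
      ((Primrec.fst.pair (Primrec.const c)).pair Primrec.snd)
  refine ⟨fun k => Nat.find (hex k), ?_, fun b hb => ?_⟩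
  · refine (Primrec.nat_rec (f := fun _ : ℕ => 0)
      (g := fun k p => bif (c.evaln p.2 k).isSome then p.2 else p.1 + 1)
      (Primrec.const 0) ?_).of_eq fun k w => ?_
    · have h : Primrec fun q : ℕ × ℕ × ℕ => q.2.2 := Primrec.snd.comp Primrec.snd
      exact Primrec.cond (Primrec.option_isSome.comp (hprim.comp h Primrec.fst)) h
        (Primrec.succ.comp (Primrec.fst.comp Primrec.snd))
    · induction w with
      | zero => simp
      | succ w ih =>
        simp only [ih]
        rcases le_or_gt (Nat.find (hex k)) w with h | h
        · rw [min_eq_left h, Nat.find_spec (hex k), min_eq_left (by omega)]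
          rfl
        · have := Nat.find_min (hex k) h
          rw [min_eq_right h.le, min_eq_right h, Bool.eq_false_iff.2 this]
          rfl
  · by_contra! hcon
    refine not_primrec_ack_self ((Primrec.option_getD.comp
      (hprim.comp hb Primrec.id) (Primrec.const 0)).of_eq fun k => ?_)
    obtain ⟨x, hx⟩ := Option.isSome_iff_exists.1 (hmono k _ _ (hcon k) (Nat.find_spec (hex k)))
    have h1 := Nat.Partrec.Code.evaln_sound (Option.mem_def.2 hx)
    simp only [id, hx, Option.getD_some]
    exact Part.mem_unique h1 (hev k)

/-- An honest sequence which is not primitive recursively bounded can be chosen with arbitrarily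
large primitive recursive gaps. -/
theorem exists_honest_unbounded_gaps {Γ : ℕ → ℕ} (hΓ : Primrec Γ)
    (hle : ∀ a, a ≤ Γ a) :
    ∃ A : ℕ → ℕ, Honest A ∧ (∀ k, Γ (A k) ≤ A (k + 1)) ∧
      ∀ b : ℕ → ℕ, Primrec b → ∃ k, b k < A k := by
  obtain ⟨T, hT, hTb⟩ := exists_honest_unbounded
  let A : ℕ → ℕ := fun k => k.rec (T 0) fun k a => Γ a + T (k + 1)
  have hA : ∀ k, A (k + 1) = Γ (A k) + T (k + 1) := fun k => rfl
  refine ⟨A, ?_, fun k => by simp [hA], fun b hb => ?_⟩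
  · have h : Primrec₂ fun w k => min (A k) w := by
      refine (Primrec.nat_rec (f := fun w => min (T 0) w)
        (g := fun w p => if p.2 = w then w else min (Γ p.2 + min (T (p.1 + 1)) w) w)
        (hT.comp (Primrec.const 0) Primrec.id) ?_).of_eq fun w k => ?_
      · have h : Primrec fun q : ℕ × ℕ × ℕ => q.2.2 := Primrec.snd.comp Primrec.snd
        refine Primrec.ite (Primrec.eq.comp h Primrec.fst) Primrec.fst (Primrec.nat_min.comp
          (Primrec.nat_add.comp (hΓ.comp h) ?_) Primrec.fst)
        exact hT.comp (Primrec.succ.comp (Primrec.fst.comp Primrec.snd)) Primrec.fst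
      · induction k with
        | zero => rfl
        | succ k ih =>
          have h1 := hle (A k)
          have h2 := hA k
          simp only [ih]
          split_ifs with h
          · omega
          · rw [min_eq_left (by omega : A k ≤ w)]
            omega
    exact h.swap
  · obtain ⟨k, hk⟩ := hTb b hb
    refine ⟨k, hk.trans_le ?_⟩
    cases k with
    | zero => exact le_rfl
    | succ k => exact Nat.le_add_left _ _

theorem Primrec.nat_count {p : ℕ → Prop} [DecidablePred p] (hp : PrimrecPred p) :
    Primrec (Nat.count p) := by
  refine (Primrec.nat_rec₁ (f := fun n r => if p n then r + 1 else r) 0 ?_).of_eq fun n => ?_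
  · exact Primrec.ite (hp.comp Primrec.fst) (Primrec.succ.comp Primrec.snd) Primrec.snd
  · induction n with
    | zero => rfl
    | succ n ih =>
      simp only [ih, Nat.count_succ]
      split_ifs <;> rfl

/-- If equality of values under a coding of the natural numbers is primitive recursive, then the
coding can be made bijective. -/
theorem exists_equiv_of_primrecRel_val_eq {val ν : ℕ → ℕ}
    (hval : PrimrecRel fun x y => val x = val y) (hν : Primrec ν) (hmono : Monotone ν)
    (hνval : ∀ n, val (ν n) = n) :
    ∃ (c : ℕ ≃ ℕ) (ρ σ : ℕ → ℕ), Primrec ρ ∧ Primrec σ ∧ (∀ x, c (val x) = ρ x) ∧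
      ∀ y, val (σ y) = c.symm y := by
  classical
  let R : ℕ → Prop := fun x => ∀ y < x, val y ≠ val x
  have hRp : PrimrecPred R :=
    (PrimrecRel.forall_lt (R := fun y x => val y ≠ val x) hval.not).comp Primrec.id Primrec.id
  have hex : ∀ x, ∃ y, val y = val x := fun x => ⟨x, rfl⟩
  let rep : ℕ → ℕ := fun x => Nat.find (hex x)
  have hrep : ∀ x, val (rep x) = val x := fun x => Nat.find_spec (hex x)
  have hrepR : ∀ x, R (rep x) := fun x y hy h => Nat.find_min (hex x) hy (h.trans (hrep x))
  have hrep_le : ∀ x, rep x ≤ x := fun x => Nat.find_min' (hex x) rfl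
  have hrepp : Primrec rep := by
    have hP : PrimrecRel fun x z => ∀ y < z, val y ≠ val x :=
      (PrimrecRel.forall_lt (R := fun y x => val y ≠ val x) hval.not).comp Primrec.snd Primrec.fst
    refine (Primrec.nat_findGreatest Primrec.id hP).of_eq fun x => ?_
    rw [Nat.findGreatest_eq_iff]
    exact ⟨hrep_le x, fun _ y hy => Nat.find_min (hex x) hy, fun z hz _ h => h _ hz (hrep x)⟩
  have hRinj : ∀ x y, R x → R y → val x = val y → x = y := fun x y hx hy h => by
    rcases lt_trichotomy x y with h' | h' | h'
    · exact absurd h (hy x h')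
    · exact h'
    · exact absurd h.symm (hx y h')
  have hinj : Function.Injective fun n => rep (ν n) := fun m n h => by
    have := congrArg val h
    simpa [hrep, hνval] using this
  have hinf : {x | R x}.Infinite := Set.infinite_of_injective_forall_mem hinj fun n => hrepR _
  have hnthR : ∀ y, R (Nat.nth R y) := Nat.nth_mem_of_infinite hinf
  have hnth_le : ∀ y, Nat.nth R y ≤ ν y := fun y => by
    refine Nat.lt_succ_iff.1 (Nat.nth_lt_of_lt_count (Nat.lt_of_succ_le ?_))
    rw [Nat.count_eq_card_filter_range]
    calc y + 1 = ((Finset.range (y + 1)).image fun n => rep (ν n)).card := by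
          rw [Finset.card_image_of_injective _ hinj, Finset.card_range]
      _ ≤ _ := Finset.card_le_card fun x hx => by
          obtain ⟨n, hn, rfl⟩ := Finset.mem_image.1 hx
          have h1 := hmono (Nat.lt_succ_iff.1 (Finset.mem_range.1 hn))
          have h2 := hrep_le (ν n)
          exact Finset.mem_filter.2 ⟨Finset.mem_range.2 (by omega), hrepR _⟩
  have hnth : Primrec (Nat.nth R) := by
    have hP : PrimrecRel fun y x => Nat.count R x ≤ y :=
      Primrec.nat_le.comp ((Primrec.nat_count hRp).comp Primrec.snd) Primrec.fst
    refine (Primrec.nat_findGreatest hν hP).of_eq fun y => ?_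
    rw [Nat.findGreatest_eq_iff]
    refine ⟨hnth_le y, fun _ => (Nat.count_nth_of_infinite hinf y).le, fun x hx _ => ?_⟩
    have := Nat.count_monotone R (Nat.succ_le_of_lt hx)
    rw [Nat.succ_eq_add_one, Nat.count_succ, if_pos (hnthR y),
      Nat.count_nth_of_infinite hinf] at this
    omega
  have hnth_count : ∀ x, val (Nat.nth R (Nat.count R (rep x))) = val x := fun x => by
    rw [Nat.nth_count (hrepR x), hrep]
  let d : ℕ ≃ ℕ := Equiv.ofBijective (fun y => val (Nat.nth R y))
    ⟨fun x y h => Nat.nth_injective hinf (hRinj _ _ (hnthR x) (hnthR y) h),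
      fun n => ⟨_, (hnth_count (ν n)).trans (hνval n)⟩⟩
  refine ⟨d.symm, fun x => Nat.count R (rep x), Nat.nth R, (Primrec.nat_count hRp).comp hrepp,
    hnth, fun x => ?_, fun y => rfl⟩
  rw [Equiv.symm_apply_eq]
  exact (hnth_count x).symm

/-- The value of a code: `pair 0 n` codes `n`, and `pair (k + 1) i` codes the value of the `i`-th
term at `N k`. -/
def codeVal (N : ℕ → ℕ) (x : ℕ) : ℕ :=
  if x.unpair.1 = 0 then x.unpair.2 else termVal x.unpair.2 (N (x.unpair.1 - 1))

/-- The value of a code for `N = G ∘ A`, provided it can be computed using only those values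
of `A` which are at most `w`. -/
def partialVal (G A : ℕ → ℕ) (w x : ℕ) : Option ℕ :=
  if x.unpair.1 = 0 then some x.unpair.2
  else if termVal x.unpair.2 1 = termVal x.unpair.2 2 then some (termVal x.unpair.2 0)
  else if min (A (x.unpair.1 - 1)) (w + 1) ≤ w then
    some (termVal x.unpair.2 (G (min (A (x.unpair.1 - 1)) (w + 1))))
  else none

theorem exists_pair_eq (x : ℕ) : (∃ n, x = Nat.pair 0 n) ∨ ∃ k i, x = Nat.pair (k + 1) i := by
  have h := Nat.pair_unpair x
  rcases h1 : x.unpair.1 with _ | k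
  · exact Or.inl ⟨_, by rw [← h1, h]⟩
  · exact Or.inr ⟨k, _, by rw [← h1, h]⟩

theorem codeVal_pair_zero (N : ℕ → ℕ) (n : ℕ) : codeVal N (Nat.pair 0 n) = n := by
  simp [codeVal]

theorem codeVal_pair_succ (N : ℕ → ℕ) (k i : ℕ) :
    codeVal N (Nat.pair (k + 1) i) = termVal i (N k) := by
  simp [codeVal]

section partialVal

variable {G A : ℕ → ℕ}

theorem primrec_partialVal (hG : Primrec G) (hA : Honest A) : Primrec₂ (partialVal G A) := by
  have h1 : Primrec fun p : ℕ × ℕ => p.2.unpair.1 :=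
    Primrec.fst.comp (Primrec.unpair.comp Primrec.snd)
  have h2 : Primrec fun p : ℕ × ℕ => p.2.unpair.2 :=
    Primrec.snd.comp (Primrec.unpair.comp Primrec.snd)
  have hmin : Primrec fun p : ℕ × ℕ => min (A (p.2.unpair.1 - 1)) (p.1 + 1) :=
    hA.comp (Primrec.pred.comp h1) (Primrec.succ.comp Primrec.fst)
  refine Primrec.ite (Primrec.eq.comp h1 (Primrec.const 0)) (Primrec.option_some.comp h2) ?_
  refine Primrec.ite (Primrec.eq.comp (Primrec.termVal.comp h2 (Primrec.const 1))
    (Primrec.termVal.comp h2 (Primrec.const 2)))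
    (Primrec.option_some.comp (Primrec.termVal.comp h2 (Primrec.const 0))) ?_
  exact Primrec.ite (Primrec.nat_le.comp hmin Primrec.fst)
    (Primrec.option_some.comp (Primrec.termVal.comp h2 (hG.comp hmin))) (Primrec.const none)

theorem codeVal_eq_of_partialVal_eq_some {w x v : ℕ} (h : partialVal G A w x = some v) :
    codeVal (G ∘ A) x = v := by
  rcases exists_pair_eq x with ⟨n, rfl⟩ | ⟨k, i, rfl⟩
  · rw [codeVal_pair_zero]
    simpa [partialVal] using h
  · rw [codeVal_pair_succ]
    simp only [partialVal, Nat.unpair_pair, Nat.add_one_ne_zero, if_false,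
      Nat.add_sub_cancel] at h
    split_ifs at h with h1 h2
    · rcases termVal_const_or_le i with hc | hc
      · rw [hc]
        exact Option.some.inj h
      · exact absurd h1 hc.2.ne
    · rw [min_eq_left (by omega)] at h
      exact Option.some.inj h

theorem eq_pair_of_partialVal_eq_none {w x : ℕ} (h : partialVal G A w x = none) :
    ∃ k i, x = Nat.pair (k + 1) i ∧ w < A k ∧ ∀ y, y ≤ termVal i y := by
  rcases exists_pair_eq x with ⟨n, rfl⟩ | ⟨k, i, rfl⟩
  · simp [partialVal] at h
  · simp only [partialVal, Nat.unpair_pair, Nat.add_one_ne_zero, if_false,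
      Nat.add_sub_cancel] at h
    split_ifs at h with h1 h2
    refine ⟨k, i, rfl, by omega, ?_⟩
    rcases termVal_const_or_le i with hc | hc
    · exact absurd ((hc 1).trans (hc 2).symm) h1
    · exact hc.1

theorem strictMono_of_gap (hle : ∀ m, m ≤ G m)
    (hgap : ∀ k, ∀ i ≤ A k, termVal i (G (A k)) + 2 ≤ A (k + 1)) : StrictMono A := by
  refine strictMono_nat_of_lt_succ fun k => ?_
  have h1 := hgap k 0 (Nat.zero_le _)
  have h2 := hle (A k)
  rw [termVal_zero] at h1
  omega

theorem primrecRel_codeVal_eq (hG : Primrec G) (hA : Honest A) (hle : ∀ m, m ≤ G m)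
    (hsep : ∀ m, ∀ i ≤ m, ∀ j ≤ m, termVal i (G m) = termVal j (G m) → termVal i = termVal j)
    (hgap : ∀ k, ∀ i ≤ A k, termVal i (G (A k)) + 2 ≤ A (k + 1)) :
    PrimrecRel fun x y => codeVal (G ∘ A) x = codeVal (G ∘ A) y := by
  let E : ℕ → ℕ → Prop := fun x y => (partialVal G A (x + y) x).isSome ∧
    partialVal G A (x + y + (partialVal G A (x + y) x).getD 0) y = partialVal G A (x + y) x
  have hV := primrec_partialVal hG hA
  have hE : PrimrecRel E := by
    have h1 : Primrec fun p : ℕ × ℕ => partialVal G A (p.1 + p.2) p.1 :=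
      hV.comp Primrec.nat_add Primrec.fst
    refine PrimrecPred.and (Primrec.eq.comp (Primrec.option_isSome.comp h1) (Primrec.const true))
      (Primrec.eq.comp (hV.comp (Primrec.nat_add.comp Primrec.nat_add
        (Primrec.option_getD.comp h1 (Primrec.const 0))) Primrec.snd) h1)
  have hE_eq : ∀ x y, E x y → codeVal (G ∘ A) x = codeVal (G ∘ A) y := fun x y ⟨h1, h2⟩ => by
    obtain ⟨v, hv⟩ := Option.isSome_iff_exists.1 h1
    rw [codeVal_eq_of_partialVal_eq_some hv, codeVal_eq_of_partialVal_eq_some (h2.trans hv)]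
  have hE_of : ∀ x y v, codeVal (G ∘ A) x = codeVal (G ∘ A) y →
      partialVal G A (x + y) x = some v → E x y := fun x y v h hv => by
    refine ⟨by rw [hv]; rfl, ?_⟩
    rw [hv, Option.getD_some]
    rcases hy : partialVal G A (x + y + v) y with _ | v'
    · obtain ⟨k, i, rfl, hw, hi⟩ := eq_pair_of_partialVal_eq_none hy
      have h1 := hi (G (A k))
      have h2 := hle (A k)
      rw [codeVal_eq_of_partialVal_eq_some hv, codeVal_pair_succ, Function.comp_apply] at h
      omega
    · rw [← codeVal_eq_of_partialVal_eq_some hv, h, codeVal_eq_of_partialVal_eq_some hy]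
  have hmono := strictMono_of_gap hle hgap
  have hlt : ∀ k l i j w, i ≤ w → w < A k → (∀ y, y ≤ termVal j y) → k < l →
      termVal i (G (A k)) ≠ termVal j (G (A l)) := fun k l i j w hi hw hj hkl => by
    have h1 := hgap k i (by omega)
    have h2 := hmono.monotone (Nat.succ_le_of_lt hkl)
    have h3 := hle (A l)
    have h4 := hj (G (A l))
    simp only [Nat.succ_eq_add_one] at h2
    omega
  have h1 : Primrec fun x : ℕ => x.unpair.1 := Primrec.fst.comp Primrec.unpair
  have h2 : Primrec fun x : ℕ => x.unpair.2 := Primrec.snd.comp Primrec.unpair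
  have hT : PrimrecRel fun x y : ℕ => ¬ x.unpair.1 = 0 ∧ x.unpair.1 = y.unpair.1 ∧
      termVal x.unpair.2 = termVal y.unpair.2 :=
    (Primrec.eq.comp (h1.comp Primrec.fst) (Primrec.const 0)).not.and
      ((Primrec.eq.comp (h1.comp Primrec.fst) (h1.comp Primrec.snd)).and
        (primrecRel_termVal_eq.comp (h2.comp Primrec.fst) (h2.comp Primrec.snd)))
  refine (hE.or ((hE.comp Primrec.snd Primrec.fst).or hT)).of_eq ?_
  rintro ⟨x, y⟩
  constructor
  · rintro (h | h | ⟨h, h', h''⟩)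
    · exact hE_eq _ _ h
    · exact (hE_eq _ _ h).symm
    · simp only [codeVal, ← h', h, if_false, h'']
  · intro h
    rcases hx : partialVal G A (x + y) x with _ | v
    · rcases hy : partialVal G A (x + y) y with _ | v
      · obtain ⟨k, i, hxk, hk, hi⟩ := eq_pair_of_partialVal_eq_none hx
        obtain ⟨l, j, hyl, hl, hj⟩ := eq_pair_of_partialVal_eq_none hy
        have hix : i ≤ x + y := by
          have := Nat.right_le_pair (k + 1) i
          omega
        have hjy : j ≤ x + y := by
          have := Nat.right_le_pair (l + 1) j
          omega
        simp only [hxk, hyl, codeVal_pair_succ, Function.comp_apply] at h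
        rcases lt_trichotomy k l with hkl | rfl | hkl
        · exact absurd h (hlt k l i j _ hix hk hj hkl)
        · refine Or.inr (Or.inr ?_)
          simpa [hxk, hyl] using hsep _ i (by omega) j (by omega) h
        · exact absurd h.symm (hlt l k j i _ hjy hl hi hkl)
      · exact Or.inr (Or.inl (hE_of y x v h.symm (by rwa [add_comm])))
    · exact Or.inl (hE_of x y v h hx)

/-- No primitive recursive function on codes computes the predecessor. -/
theorem not_primrec_pred_codeVal (hG : Primrec G) (hA : Honest A) (hle : ∀ m, m ≤ G m)
    (hgap : ∀ k, ∀ i ≤ A k, termVal i (G (A k)) + 2 ≤ A (k + 1))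
    (hbd : ∀ b : ℕ → ℕ, Primrec b → ∃ k, b k < A k) {P : ℕ → ℕ} (hP : Primrec P)
    (hval : ∀ x, codeVal (G ∘ A) (P x) = (codeVal (G ∘ A) x).pred) : False := by
  let y : ℕ → ℕ := fun k => P (Nat.pair (k + 1) 0)
  have hy : Primrec y := hP.comp (Primrec₂.natPair.comp Primrec.succ (Primrec.const 0))
  have hyval : ∀ k, codeVal (G ∘ A) (y k) = G (A k) - 1 := fun k => by
    simp [y, hval, codeVal_pair_succ, termVal_zero]
  have hmono := strictMono_of_gap hle hgap
  obtain ⟨k, hk⟩ := hbd _ (Primrec.succ.comp (Primrec.option_getD.comp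
    ((primrec_partialVal hG hA).comp hy hy) (Primrec.const 0)))
  have hk1 := hyval k
  have hk2 := hle (A k)
  rcases h : partialVal G A (y k) (y k) with _ | v
  · obtain ⟨l, i, hyl, hl, hi⟩ := eq_pair_of_partialVal_eq_none h
    have hiy := Nat.right_le_pair (l + 1) i
    rw [← hyl] at hiy
    rw [hyl, codeVal_pair_succ, Function.comp_apply] at hk1
    have h1 := hi (G (A l))
    have h2 := hgap l i (by omega)
    have h3 := hle (A l)
    rcases lt_trichotomy l k with hlk | rfl | hlk
    · have := hmono.monotone (Nat.succ_le_of_lt hlk)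
      simp only [Nat.succ_eq_add_one] at this
      omega
    · omega
    · have h4 := hgap k 0 (Nat.zero_le _)
      have h5 := hmono.monotone (Nat.succ_le_of_lt hlk)
      simp only [Nat.succ_eq_add_one, termVal_zero] at h4 h5
      omega
  · rw [codeVal_eq_of_partialVal_eq_some h] at hk1
    simp only [h, Option.getD_some] at hk
    omega

end partialVal

/-- There is an honest sequence `A`, not primitive recursively bounded, all of whose gaps contain
the values at `G (A k)` of the terms with small codes. -/
theorem exists_separating_gap : ∃ G A : ℕ → ℕ, Primrec G ∧ Honest A ∧ (∀ m, m ≤ G m) ∧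
    (∀ m, ∀ i ≤ m, ∀ j ≤ m, termVal i (G m) = termVal j (G m) → termVal i = termVal j) ∧
    (∀ k, ∀ i ≤ A k, termVal i (G (A k)) + 2 ≤ A (k + 1)) ∧
    ∀ b : ℕ → ℕ, Primrec b → ∃ k, b k < A k := by
  obtain ⟨G, hG, hle, hsep⟩ := exists_primrec_separating
  let Γ : ℕ → ℕ := fun m => ∑ i ∈ Finset.range (m + 1), termVal i (G m) + 2
  have hΓ : Primrec Γ := by
    have h : Primrec₂ fun m n => ∑ i ∈ Finset.range n, termVal i (G m) := by
      refine (Primrec.nat_rec (f := fun _ : ℕ => 0)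
        (g := fun m p => p.2 + termVal p.1 (G m)) (Primrec.const 0) ?_).of_eq fun m n => ?_
      · exact Primrec.nat_add.comp (Primrec.snd.comp Primrec.snd)
          (Primrec.termVal.comp (Primrec.fst.comp Primrec.snd) (hG.comp Primrec.fst))
      · induction n with
        | zero => rfl
        | succ n ih => rw [Finset.sum_range_succ, ← ih]
    exact Primrec.nat_add.comp (h.comp Primrec.id Primrec.succ) (Primrec.const 2)
  have hΓle : ∀ m, ∀ i ≤ m, termVal i (G m) + 2 ≤ Γ m := fun m i hi =>
    Nat.add_le_add_right (Finset.single_le_sum (f := fun i => termVal i (G m))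
      (fun _ _ => Nat.zero_le _) (Finset.mem_range.2 (Nat.lt_succ_of_le hi))) 2
  obtain ⟨A, hA, hgap, hbd⟩ := exists_honest_unbounded_gaps hΓ fun m => by
    have h1 := hΓle m 0 (Nat.zero_le _)
    have h2 := hle m
    rw [termVal_zero] at h1
    omega
  exact ⟨G, A, hG, hA, hle, hsep, fun k i hi => (hΓle _ i hi).trans (hgap k), hbd⟩

theorem LevitzC.exists_primrec_codeVal {f : ℕ → ℕ} (hf : LevitzC f) (N : ℕ → ℕ) :
    ∃ F : ℕ → ℕ, Primrec F ∧ ∀ x, codeVal N (F x) = f (codeVal N x) := by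
  obtain ⟨φ, hφ, hφ'⟩ := hf.exists_term_comp
  have h1 : Primrec fun x : ℕ => x.unpair.1 := Primrec.fst.comp Primrec.unpair
  have h2 : Primrec fun x : ℕ => x.unpair.2 := Primrec.snd.comp Primrec.unpair
  refine ⟨fun x => Nat.pair x.unpair.1 (if x.unpair.1 = 0 then f x.unpair.2 else φ x.unpair.2),
    Primrec₂.natPair.comp h1 (Primrec.ite (Primrec.eq.comp h1 (Primrec.const 0))
      (hf.primrec.comp h2) (hφ.comp h2)), fun x => ?_⟩
  rcases exists_pair_eq x with ⟨n, rfl⟩ | ⟨k, i, rfl⟩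
  · simp [codeVal_pair_zero]
  · simp [codeVal_pair_succ, hφ']

theorem stmt_6 : ∃ c : ℕ ≃ ℕ,
    Primrec (fun x => c (c.symm x + 1)) ∧
    (∀ f : ℕ → ℕ, LevitzC f → Primrec (fun x => c (f (c.symm x)))) ∧
    ¬ Primrec (fun x => c (Nat.pred (c.symm x))) := by
  obtain ⟨G, A, hG, hA, hle, hsep, hgap, hbd⟩ := exists_separating_gap
  obtain ⟨c, ρ, σ, hρ, hσ, hcρ, hcσ⟩ := exists_equiv_of_primrecRel_val_eq
    (primrecRel_codeVal_eq hG hA hle hsep hgap)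
    (Primrec₂.natPair.comp (Primrec.const 0) Primrec.id)
    (StrictMono.monotone fun _ _ h => Nat.pair_lt_pair_right 0 h) (codeVal_pair_zero _)
  have hL : ∀ f : ℕ → ℕ, LevitzC f → Primrec fun x => c (f (c.symm x)) := fun f hf => by
    obtain ⟨F, hF, hFval⟩ := hf.exists_primrec_codeVal (G ∘ A)
    exact (hρ.comp (hF.comp hσ)).of_eq fun x => by rw [← hcρ, hFval, hcσ]
  refine ⟨c, hL _ (LevitzC.id.add LevitzC.one), hL, fun hpred => ?_⟩
  exact not_primrec_pred_codeVal hG hA hle hgap hbd (hσ.comp (hpred.comp hρ)) fun x => by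
    rw [hcσ, Equiv.symm_apply_apply, ← hcρ, Equiv.symm_apply_apply]
end

section
/- There exist a bijection c : ℕ ≃ ℕ with c ∘ S ∘ c⁻¹ primitive recursive (where S x = x + 1) and a primitive recursive function u : ℕ → ℕ such that the function c⁻¹ ∘ u ∘ c is not primitive recursive. (Equivalently: there is a non-primitive-recursive function f : ℕ → ℕ whose conjugate c ∘ f ∘ c⁻¹ is primitive recursive.) -/
/-- A total computable function that is not primitive recursive has a primitive recursive, monotone
halting predicate whose halting time is not primitive recursive. -/
theorem exists_primrec_monotone_not_primrec_find :
    ∃ R : ℕ → ℕ → Bool, Primrec₂ R ∧ (∀ j, R j 0 = false) ∧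
      (∀ j s t, s ≤ t → R j s = true → R j t = true) ∧
      ∃ h : ∀ j, ∃ t, R j t = true, ¬ Primrec fun j => Nat.find (h j) := by
  have hack : Computable fun n => ack n n := computable₂_ack.comp Computable.id Computable.id
  obtain ⟨e, he⟩ := Nat.Partrec.Code.exists_code.1 (Partrec.nat_iff.1 hack)
  have hmem : ∀ j x, x ∈ e.eval j ↔ x = ack j j := by
    intro j x
    rw [he]
    exact Part.mem_some_iff
  have heval : Primrec₂ fun j t => Nat.Partrec.Code.evaln t e j :=
    Nat.Partrec.Code.primrec_evaln.comp
      (Primrec.pair (Primrec.pair Primrec.snd (Primrec.const e)) Primrec.fst)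
  have hhalt : ∀ j, ∃ t, (Nat.Partrec.Code.evaln t e j).isSome = true := by
    intro j
    obtain ⟨t, ht⟩ := Nat.Partrec.Code.evaln_complete.1 ((hmem j _).2 rfl)
    exact ⟨t, Option.isSome_iff_exists.2 ⟨_, ht⟩⟩
  refine ⟨fun j t => (Nat.Partrec.Code.evaln t e j).isSome, Primrec.option_isSome.comp heval,
    fun j => by simp [Nat.Partrec.Code.evaln], fun j s t hst hs => ?_, hhalt, fun hK => ?_⟩
  · obtain ⟨x, hx⟩ := Option.isSome_iff_exists.1 hs
    exact Option.isSome_iff_exists.2 ⟨x, Nat.Partrec.Code.evaln_mono hst hx⟩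
  · refine not_primrec_ack_self ((Primrec.option_getD.comp
      (heval.comp Primrec.id hK) (Primrec.const 0)).of_eq fun j => ?_)
    obtain ⟨x, hx⟩ := Option.isSome_iff_exists.1 (Nat.find_spec (hhalt j))
    have hxj := (hmem j x).1 (Nat.Partrec.Code.evaln_sound hx)
    simp [hx, hxj]

namespace DelayedSuccessor

/-- Whether `m`, read as a pair `(j, t)`, lies past the halting time of `j`. -/
def halted (R : ℕ → ℕ → Bool) (m : ℕ) : Bool := R m.unpair.1 m.unpair.2

/-- The successor of the copy. The odd numbers `2 * ⟨j, t⟩ + 1` with `t` before the halting time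
of `j` form a block, traversed in the order of `t`. The block is followed by `2 * j`, then by
`2 * j + 1` if this number belongs to no block, and then by the block of `j + 1`. -/
def next (R : ℕ → ℕ → Bool) (x : ℕ) : ℕ :=
  if x % 2 = 0 then
    if halted R (x / 2) = true then x + 1 else 2 * Nat.pair (x / 2 + 1) 0 + 1
  else if halted R (x / 2) = true then 2 * Nat.pair (x / 2 + 1) 0 + 1
  else if R (x / 2).unpair.1 ((x / 2).unpair.2 + 1) = true then 2 * (x / 2).unpair.1
  else 2 * Nat.pair (x / 2).unpair.1 ((x / 2).unpair.2 + 1) + 1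

/-- The position at which the block of `j` starts, `K` being the block lengths. -/
def start (R : ℕ → ℕ → Bool) (K : ℕ → ℕ) : ℕ → ℕ
  | 0 => 0
  | j + 1 => start R K j + K j + if halted R j = true then 2 else 1

/-- The position of `x` in the copy. -/
def rank (R : ℕ → ℕ → Bool) (K : ℕ → ℕ) (x : ℕ) : ℕ :=
  if x % 2 = 0 then start R K (x / 2) + K (x / 2)
  else if halted R (x / 2) = true then start R K (x / 2) + K (x / 2) + 1
  else start R K (x / 2).unpair.1 + (x / 2).unpair.2

theorem primrec_halted {R : ℕ → ℕ → Bool} (hR : Primrec₂ R) : Primrec (halted R) :=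
  hR.comp (Primrec.fst.comp Primrec.unpair) (Primrec.snd.comp Primrec.unpair)

theorem primrec_next {R : ℕ → ℕ → Bool} (hR : Primrec₂ R) : Primrec (next R) := by
  have half : Primrec fun x : ℕ => x / 2 := Primrec.nat_div.comp Primrec.id (Primrec.const 2)
  have odd {f : ℕ → ℕ} (hf : Primrec f) : Primrec fun x => 2 * f x + 1 :=
    Primrec.succ.comp (Primrec.nat_mul.comp (Primrec.const 2) hf)
  have block : Primrec fun x : ℕ => (x / 2).unpair.1 :=
    Primrec.fst.comp (Primrec.unpair.comp half)
  have step : Primrec fun x : ℕ => (x / 2).unpair.2 + 1 :=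
    Primrec.succ.comp (Primrec.snd.comp (Primrec.unpair.comp half))
  have jump : Primrec fun x : ℕ => 2 * Nat.pair (x / 2 + 1) 0 + 1 :=
    odd (Primrec₂.natPair.comp (Primrec.succ.comp half) (Primrec.const 0))
  have hhalf : PrimrecPred fun x => halted R (x / 2) = true :=
    Primrec.eq.comp ((primrec_halted hR).comp half) (Primrec.const true)
  exact Primrec.ite
    (Primrec.eq.comp (Primrec.nat_mod.comp Primrec.id (Primrec.const 2)) (Primrec.const 0))
    (Primrec.ite hhalf Primrec.succ jump)
    (Primrec.ite hhalf jump
      (Primrec.ite (Primrec.eq.comp (hR.comp block step) (Primrec.const true))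
        (Primrec.nat_mul.comp (Primrec.const 2) block)
        (odd (Primrec₂.natPair.comp block step))))

section

variable {R : ℕ → ℕ → Bool} {K : ℕ → ℕ}

theorem next_even (m : ℕ) : next R (2 * m) =
    if halted R m = true then 2 * m + 1 else 2 * Nat.pair (m + 1) 0 + 1 := by
  simp [next]

theorem next_odd_of_halted {m : ℕ} (hm : halted R m = true) :
    next R (2 * m + 1) = 2 * Nat.pair (m + 1) 0 + 1 := by
  have h : (2 * m + 1) / 2 = m := by omega
  simp [next, h, hm, Nat.add_mod]

theorem next_block {j t : ℕ} (h : R j t = false) : next R (2 * Nat.pair j t + 1) =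
    if R j (t + 1) = true then 2 * j else 2 * Nat.pair j (t + 1) + 1 := by
  have h2 : (2 * Nat.pair j t + 1) / 2 = Nat.pair j t := by omega
  simp [next, h2, h, halted, Nat.add_mod]

theorem rank_even (m : ℕ) : rank R K (2 * m) = start R K m + K m := by
  simp [rank]

theorem rank_odd_of_halted {m : ℕ} (hm : halted R m = true) :
    rank R K (2 * m + 1) = start R K m + K m + 1 := by
  have h : (2 * m + 1) / 2 = m := by omega
  simp [rank, h, hm, Nat.add_mod]

theorem rank_block {j t : ℕ} (h : R j t = false) :
    rank R K (2 * Nat.pair j t + 1) = start R K j + t := by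
  have h2 : (2 * Nat.pair j t + 1) / 2 = Nat.pair j t := by omega
  simp [rank, h2, h, halted, Nat.add_mod]

/-- Every number is an even number, an odd number outside the blocks or a block element. -/
theorem cases_position (R : ℕ → ℕ → Bool) (x : ℕ) :
    (∃ m, x = 2 * m) ∨ (∃ m, halted R m = true ∧ x = 2 * m + 1) ∨
      ∃ j t, R j t = false ∧ x = 2 * Nat.pair j t + 1 := by
  rcases Nat.even_or_odd' x with ⟨m, rfl | rfl⟩
  · exact Or.inl ⟨m, rfl⟩
  · by_cases hm : halted R m = true
    · exact Or.inr (Or.inl ⟨m, hm, rfl⟩)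
    · exact Or.inr (Or.inr ⟨m.unpair.1, m.unpair.2, by simpa [halted] using hm, by simp⟩)

theorem rank_next (hK : ∀ j t, R j t = true ↔ K j ≤ t) (h0 : ∀ j, R j 0 = false) (x : ℕ) :
    rank R K (next R x) = rank R K x + 1 := by
  rcases cases_position R x with ⟨m, rfl⟩ | ⟨m, hm, rfl⟩ | ⟨j, t, hjt, rfl⟩
  · rw [next_even, rank_even]
    split_ifs with hm
    · rw [rank_odd_of_halted hm]
    · rw [rank_block (h0 _), start, if_neg hm]
  · rw [next_odd_of_halted hm, rank_odd_of_halted hm, rank_block (h0 _), start, if_pos hm]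
  · rw [next_block hjt, rank_block hjt]
    have hlt : ¬ K j ≤ t := by simp [← hK, hjt]
    split_ifs with h
    · have := (hK _ _).1 h
      rw [rank_even]
      omega
    · rw [rank_block (by simpa using h), add_assoc]

theorem exists_next_eq (hK : ∀ j t, R j t = true ↔ K j ≤ t) (h0 : ∀ j, R j 0 = false) {x : ℕ}
    (hx : x ≠ 1) : ∃ y, next R y = x := by
  rcases cases_position R x with ⟨m, rfl⟩ | ⟨m, hm, rfl⟩ | ⟨j, t, hjt, rfl⟩
  · have hpos : ¬ K m ≤ 0 := by simp [← hK, h0]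
    have hpred : R m (K m - 1) = false := by
      rw [← Bool.not_eq_true, hK]
      omega
    refine ⟨2 * Nat.pair m (K m - 1) + 1, ?_⟩
    rw [next_block hpred, if_pos ((hK _ _).2 (by omega))]
  · exact ⟨2 * m, by rw [next_even, if_pos hm]⟩
  · rcases t with _ | t
    · rcases j with _ | j
      · exact absurd (by simp [Nat.pair]) hx
      · by_cases hj : halted R j = true
        · exact ⟨2 * j + 1, next_odd_of_halted hj⟩
        · exact ⟨2 * j, by rw [next_even, if_neg hj]⟩
    · have ht : R j t = false := by
        rw [← Bool.not_eq_true, hK] at hjt ⊢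
        omega
      exact ⟨2 * Nat.pair j t + 1, by rw [next_block ht, if_neg (by simp [hjt])]⟩

theorem rank_one (h0 : ∀ j, R j 0 = false) : rank R K 1 = 0 := by
  simpa [Nat.pair, start] using rank_block (K := K) (h0 0)

/-- The copy of `ℕ` with successor `next R`, enumerated from its least element `1`. -/
def copy (hK : ∀ j t, R j t = true ↔ K j ≤ t) (h0 : ∀ j, R j 0 = false) : ℕ ≃ ℕ where
  toFun n := (next R)^[n] 1
  invFun := rank R K
  left_inv n := by
    induction n with
    | zero => exact rank_one h0
    | succ n ih =>
      dsimp only at ih ⊢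
      rw [Function.iterate_succ_apply', rank_next hK h0, ih]
  right_inv x := by
    induction hn : rank R K x generalizing x with
    | zero =>
      by_contra hx
      obtain ⟨y, rfl⟩ := exists_next_eq hK h0 (Ne.symm hx)
      simp [rank_next hK h0] at hn
    | succ n ih =>
      have hx : x ≠ 1 := by
        rintro rfl
        simp [rank_one h0] at hn
      obtain ⟨y, rfl⟩ := exists_next_eq hK h0 hx
      rw [rank_next hK h0] at hn
      dsimp only at ih ⊢
      rw [Function.iterate_succ_apply', ih y (by omega)]

theorem copy_symm_apply (hK : ∀ j t, R j t = true ↔ K j ≤ t) (h0 : ∀ j, R j 0 = false) (x : ℕ) :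
    (copy hK h0).symm x = rank R K x := rfl

theorem copy_symm_add_one (hK : ∀ j t, R j t = true ↔ K j ≤ t) (h0 : ∀ j, R j 0 = false)
    (x : ℕ) : copy hK h0 ((copy hK h0).symm x + 1) = next R x := by
  rw [← Equiv.eq_symm_apply, copy_symm_apply, copy_symm_apply, rank_next hK h0]

theorem copy_start (hK : ∀ j t, R j t = true ↔ K j ≤ t) (h0 : ∀ j, R j 0 = false) (j : ℕ) :
    copy hK h0 (start R K j) = 2 * Nat.pair j 0 + 1 := by
  rw [← Equiv.eq_symm_apply, copy_symm_apply, rank_block (h0 j), add_zero]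

/-- A primitive recursive function taking the start of each block to its end yields the block
lengths. -/
theorem primrec_length {f : ℕ → ℕ} (hR : Primrec₂ R) (hf : Primrec f)
    (hfs : ∀ j, f (start R K j) = start R K j + K j) : Primrec K := by
  have hstep : Primrec₂ fun j s => f s + if halted R j = true then 2 else 1 :=
    Primrec.nat_add.comp (hf.comp Primrec.snd)
      (Primrec.ite
        (Primrec.eq.comp ((primrec_halted hR).comp Primrec.fst) (Primrec.const true))
        (Primrec.const 2) (Primrec.const 1))
  have hstart : Primrec (start R K) := by
    refine (Primrec.nat_rec₁ 0 hstep).of_eq fun j => ?_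
    induction j with
    | zero => rfl
    | succ j ih => simp only [ih, hfs, start]
  exact (Primrec.nat_sub.comp (hf.comp hstart) hstart).of_eq fun j => by simp [hfs]

end

end DelayedSuccessor

open DelayedSuccessor in
theorem stmt_7 : ∃ (c : ℕ ≃ ℕ) (u : ℕ → ℕ),
    Primrec (fun x => c (c.symm x + 1)) ∧
    Primrec u ∧
    ¬ Primrec (fun x => c.symm (u (c x))) := by
  obtain ⟨R, hR, h0, hmono, hhalt, hfind⟩ := exists_primrec_monotone_not_primrec_find
  have hK : ∀ j t, R j t = true ↔ Nat.find (hhalt j) ≤ t := fun j t =>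
    ⟨fun h => Nat.find_min' _ h, fun h => hmono j _ t h (Nat.find_spec (hhalt j))⟩
  refine ⟨copy hK h0, fun x => 2 * (x / 2).unpair.1, ?_, ?_, fun hf => hfind ?_⟩
  · exact (primrec_next hR).of_eq fun x => (copy_symm_add_one hK h0 x).symm
  · exact Primrec.nat_mul.comp (Primrec.const 2) (Primrec.fst.comp (Primrec.unpair.comp
      (Primrec.nat_div.comp Primrec.id (Primrec.const 2))))
  · refine primrec_length hR hf fun j => ?_
    have h : (2 * Nat.pair j 0 + 1) / 2 = Nat.pair j 0 := by omega
    dsimp only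
    rw [copy_start, h, Nat.unpair_pair, copy_symm_apply, rank_even]
end

section
/- There exists a bijection c : ℕ ≃ ℕ such that c ∘ S ∘ c⁻¹ is primitive recursive (where S x = x + 1), and the function c⁻¹ ∘ Pred ∘ c is not primitive recursive, where Pred is the predecessor function (Pred 0 = 0, Pred (n+1) = n). (That is, the unique function g whose conjugate c ∘ g ∘ c⁻¹ equals Pred is not primitive recursive.) -/
open Nat

/-- Odd numbers `2 * s + 1` form a main line and even numbers `2 * s` form side branches, where `s`
codes a pair `(k, j)`. The main line detours through the side points `(k, 0), …, (k, t k)` when it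
reaches the code of `(k, t k)`, and through the single side point `(k, j)` when `t k < j`. -/
def detourStep (t : ℕ → ℕ) (n : ℕ) : ℕ :=
  if n % 2 = 1 then
    if t (unpair (n / 2)).1 ≤ (unpair (n / 2)).2 then
      if (unpair (n / 2)).2 ≤ t (unpair (n / 2)).1 then 2 * pair (unpair (n / 2)).1 0 else n - 1
    else n + 2
  else
    if t (unpair (n / 2)).1 ≤ (unpair (n / 2)).2 then n + 3
    else 2 * pair (unpair (n / 2)).1 ((unpair (n / 2)).2 + 1)

/-- A left inverse of `detourStep t`. -/
def detourBack (t : ℕ → ℕ) (n : ℕ) : ℕ :=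
  if n % 2 = 1 then
    if (unpair (n / 2 - 1)).2 < t (unpair (n / 2 - 1)).1 then n - 2 else n - 3
  else if (unpair (n / 2)).2 = 0 then 2 * pair (unpair (n / 2)).1 (t (unpair (n / 2)).1) + 1
  else if (unpair (n / 2)).2 ≤ t (unpair (n / 2)).1 then
    2 * pair (unpair (n / 2)).1 ((unpair (n / 2)).2 - 1)
  else n + 1

/-- The number of side points visited between `2 * s + 1` and `2 * (s + 1) + 1`. -/
def detourLength (t : ℕ → ℕ) (s : ℕ) : ℕ :=
  if t (unpair s).1 ≤ (unpair s).2 then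
    if (unpair s).2 ≤ t (unpair s).1 then (unpair s).2 + 1 else 1
  else 0

/-- The number of steps from `1` to `2 * s + 1`. -/
def mainTime (t : ℕ → ℕ) (s : ℕ) : ℕ :=
  Nat.rec 0 (fun i r => r + (detourLength t i + 1)) s

section

variable {t : ℕ → ℕ}

lemma detourStep_main_of_lt {k j : ℕ} (h : j < t k) :
    detourStep t (2 * pair k j + 1) = 2 * (pair k j + 1) + 1 := by
  have h2 : (2 * pair k j + 1) / 2 = pair k j := by omega
  simp [detourStep, h2, Nat.add_mod, h.not_ge]
  omega

lemma detourStep_main_self (k : ℕ) :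
    detourStep t (2 * pair k (t k) + 1) = 2 * pair k 0 := by
  have h2 : (2 * pair k (t k) + 1) / 2 = pair k (t k) := by omega
  simp [detourStep, h2, Nat.add_mod]

lemma detourStep_main_of_gt {k j : ℕ} (h : t k < j) :
    detourStep t (2 * pair k j + 1) = 2 * pair k j := by
  have h2 : (2 * pair k j + 1) / 2 = pair k j := by omega
  simp [detourStep, h2, Nat.add_mod, h.le, h.not_ge]

lemma detourStep_side_of_lt {k j : ℕ} (h : j < t k) :
    detourStep t (2 * pair k j) = 2 * pair k (j + 1) := by
  simp [detourStep, h.not_ge]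

lemma detourStep_side_of_ge {k j : ℕ} (h : t k ≤ j) :
    detourStep t (2 * pair k j) = 2 * (pair k j + 1) + 1 := by
  simp [detourStep, h]
  omega

lemma exists_eq_side_or_main (n : ℕ) : ∃ k j, n = 2 * pair k j ∨ n = 2 * pair k j + 1 :=
  ⟨(unpair (n / 2)).1, (unpair (n / 2)).2, by rw [pair_unpair]; omega⟩

lemma detourStep_ne_one (n : ℕ) : detourStep t n ≠ 1 := by
  obtain ⟨k, j, rfl | rfl⟩ := exists_eq_side_or_main n
  · rcases lt_or_ge j (t k) with h | h
    · rw [detourStep_side_of_lt h]; omega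
    · rw [detourStep_side_of_ge h]; omega
  · rcases lt_trichotomy j (t k) with h | rfl | h
    · rw [detourStep_main_of_lt h]; omega
    · rw [detourStep_main_self]; omega
    · rw [detourStep_main_of_gt h]; omega

lemma detourStep_injective : Function.Injective (detourStep t) := by
  refine Function.LeftInverse.injective (g := detourBack t) fun n => ?_
  obtain ⟨k, j, rfl | rfl⟩ := exists_eq_side_or_main n
  · rcases lt_or_ge j (t k) with h | h
    · rw [detourStep_side_of_lt h]
      simp [detourBack, Nat.succ_le_of_lt h]
    · have h2 : (2 * (pair k j + 1) + 1) / 2 = pair k j + 1 := by omega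
      rw [detourStep_side_of_ge h]
      simp [detourBack, h2, Nat.add_mod, h.not_gt]
      omega
  · rcases lt_trichotomy j (t k) with h | rfl | h
    · have h2 : (2 * (pair k j + 1) + 1) / 2 = pair k j + 1 := by omega
      rw [detourStep_main_of_lt h]
      simp [detourBack, h2, Nat.add_mod, h]
      omega
    · rw [detourStep_main_self]
      simp [detourBack]
    · rw [detourStep_main_of_gt h]
      simp [detourBack, h.not_ge, (Nat.zero_le _ |>.trans_lt h).ne']

lemma iterate_detourStep_side {k i : ℕ} (h : i ≤ t k) :
    (detourStep t)^[i] (2 * pair k 0) = 2 * pair k i := by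
  induction i with
  | zero => rfl
  | succ i ih =>
    rw [Function.iterate_succ_apply', ih (by omega), detourStep_side_of_lt h]

lemma iterate_mainTime (s : ℕ) : (detourStep t)^[mainTime t s] 1 = 2 * s + 1 := by
  induction s with
  | zero => rfl
  | succ s ih =>
    change (detourStep t)^[mainTime t s + (detourLength t s + 1)] 1 = _
    rw [add_comm, Function.iterate_add_apply, ih, Function.iterate_succ_apply]
    obtain ⟨k, j, rfl⟩ : ∃ k j, s = pair k j := ⟨_, _, (pair_unpair s).symm⟩
    rcases lt_trichotomy j (t k) with h | rfl | h
    · simp [detourLength, h.not_ge, detourStep_main_of_lt h]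
    · rw [detourStep_main_self]
      simp only [detourLength, unpair_pair, le_refl, if_true]
      rw [Function.iterate_succ_apply', iterate_detourStep_side le_rfl,
        detourStep_side_of_ge le_rfl]
    · simp [detourLength, h.le, h.not_ge, detourStep_main_of_gt h, detourStep_side_of_ge h.le]

lemma le_mainTime (s : ℕ) : s ≤ mainTime t s := by
  induction s with
  | zero => exact Nat.zero_le _
  | succ s ih =>
    change s + 1 ≤ mainTime t s + (detourLength t s + 1)
    omega

lemma iterate_mainTime_add_one (k : ℕ) :
    (detourStep t)^[mainTime t (pair k (t k)) + 1] 1 = 2 * pair k 0 := by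
  rw [Function.iterate_succ_apply', iterate_mainTime, detourStep_main_self]

lemma iterate_detourStep_bijective :
    Function.Bijective fun n => (detourStep t)^[n] 1 := by
  constructor
  · have key : ∀ m d, (detourStep t)^[m] 1 ≠ (detourStep t)^[m + (d + 1)] 1 := by
      intro m d h
      rw [Function.iterate_add_apply, Function.iterate_succ_apply'] at h
      exact detourStep_ne_one _ (detourStep_injective.iterate m h).symm
    intro m n h
    rcases lt_trichotomy m n with hlt | heq | hlt
    · obtain ⟨d, rfl⟩ := Nat.exists_eq_add_of_lt hlt
      exact absurd h (key m d)
    · exact heq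
    · obtain ⟨d, rfl⟩ := Nat.exists_eq_add_of_lt hlt
      exact absurd h.symm (key n d)
  · intro n
    obtain ⟨k, j, rfl | rfl⟩ := exists_eq_side_or_main n
    · rcases le_or_gt j (t k) with h | h
      · refine ⟨j + (mainTime t (pair k (t k)) + 1), ?_⟩
        simp only
        rw [Function.iterate_add_apply, iterate_mainTime_add_one, iterate_detourStep_side h]
      · refine ⟨mainTime t (pair k j) + 1, ?_⟩
        simp only
        rw [Function.iterate_succ_apply', iterate_mainTime, detourStep_main_of_gt h]
    · exact ⟨_, iterate_mainTime _⟩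

lemma primrec_detourStep (hle : PrimrecRel fun k j => t k ≤ j)
    (hge : PrimrecRel fun k j => j ≤ t k) : Primrec (detourStep t) := by
  have hs : Primrec fun n : ℕ => unpair (n / 2) :=
    Primrec.unpair.comp (Primrec.nat_div.comp Primrec.id (Primrec.const 2))
  have hk := Primrec.fst.comp hs
  have hj := Primrec.snd.comp hs
  have hodd : PrimrecPred fun n : ℕ => n % 2 = 1 :=
    Primrec.eq.comp (Primrec.nat_mod.comp Primrec.id (Primrec.const 2)) (Primrec.const 1)
  have side : ∀ {f : ℕ → ℕ}, Primrec f → Primrec fun n => 2 * pair (unpair (n / 2)).1 (f n) :=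
    fun hf => Primrec.nat_mul.comp (Primrec.const 2) (Primrec₂.natPair.comp hk hf)
  exact Primrec.ite hodd
    (Primrec.ite (hle.comp hk hj)
      (Primrec.ite (hge.comp hk hj) (side (Primrec.const 0))
        (Primrec.nat_sub.comp Primrec.id (Primrec.const 1)))
      (Primrec.nat_add.comp Primrec.id (Primrec.const 2)))
    (Primrec.ite (hle.comp hk hj) (Primrec.nat_add.comp Primrec.id (Primrec.const 3))
      (side (Primrec.succ.comp hj)))

lemma primrec_mainTime (hle : PrimrecRel fun k j => t k ≤ j)
    (hge : PrimrecRel fun k j => j ≤ t k) : Primrec (mainTime t) := by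
  have hk : Primrec fun s : ℕ => (unpair s).1 := Primrec.fst.comp Primrec.unpair
  have hj : Primrec fun s : ℕ => (unpair s).2 := Primrec.snd.comp Primrec.unpair
  have hlen : Primrec (detourLength t) :=
    Primrec.ite (hle.comp hk hj)
      (Primrec.ite (hge.comp hk hj) (Primrec.succ.comp hj) (Primrec.const 1)) (Primrec.const 0)
  exact Primrec.nat_rec₁ 0 (Primrec.nat_add.comp Primrec.snd
    (Primrec.succ.comp (hlen.comp Primrec.fst)))

end

/-- There is a function with primitive recursive graph that is dominated by no primitive recursive
function. -/
lemma exists_primrecRel_not_dominated : ∃ t : ℕ → ℕ,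
    (PrimrecRel fun k j => t k ≤ j) ∧ (PrimrecRel fun k j => j ≤ t k) ∧
    ∀ b : ℕ → ℕ, Primrec b → ¬ ∀ k, t k ≤ b k := by
  classical
  have hack : Computable fun n => ack n n := computable₂_ack.comp Computable.id Computable.id
  obtain ⟨c, hc⟩ := Nat.Partrec.Code.exists_code.1 (Partrec.nat_iff.1 hack)
  have hex : ∀ k, ∃ j, ack k k ∈ Nat.Partrec.Code.evaln j c k := fun k =>
    Nat.Partrec.Code.evaln_complete.1 (by rw [hc]; exact Part.mem_some _)
  have hle : ∀ k j, Nat.find (hex k) ≤ j ↔ (Nat.Partrec.Code.evaln j c k).isSome = true := by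
    intro k j
    constructor
    · intro h
      exact Option.isSome_of_mem (Nat.Partrec.Code.evaln_mono h (Nat.find_spec (hex k)))
    · intro h
      obtain ⟨x, hx⟩ := Option.isSome_iff_exists.1 h
      have hx' := Nat.Partrec.Code.evaln_sound hx
      rw [hc] at hx'
      obtain rfl : x = ack k k := Part.mem_some_iff.1 hx'
      exact Nat.find_min' _ hx
  have heval : ∀ {b : ℕ × ℕ → ℕ}, Primrec b →
      Primrec fun p : ℕ × ℕ => Nat.Partrec.Code.evaln (b p) c p.1 := fun hb =>
    Nat.Partrec.Code.primrec_evaln.comp ((hb.pair (Primrec.const c)).pair Primrec.fst)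
  have hsome : ∀ {b : ℕ × ℕ → ℕ}, Primrec b →
      PrimrecPred fun p : ℕ × ℕ => (Nat.Partrec.Code.evaln (b p) c p.1).isSome = true := fun hb =>
    Primrec.eq.comp (Primrec.option_isSome.comp (heval hb)) (Primrec.const true)
  refine ⟨fun k => Nat.find (hex k), ?_, ?_, ?_⟩
  · exact (hsome Primrec.snd).of_eq fun p => (hle p.1 p.2).symm
  · refine PrimrecPred.of_eq ((Primrec.eq.comp Primrec.snd (Primrec.const 0)).or
      (hsome (Primrec.pred.comp Primrec.snd)).not) fun p => ?_
    rw [← hle]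
    beta_reduce
    generalize Nat.find (hex p.1) = a
    rw [Nat.pred_eq_sub_one]
    omega
  · intro b hb hdom
    refine not_primrec_ack_self ((Primrec.option_getD.comp
      (Nat.Partrec.Code.primrec_evaln.comp ((hb.pair (Primrec.const c)).pair Primrec.id))
      (Primrec.const 0)).of_eq fun k => ?_)
    have h := Nat.Partrec.Code.evaln_mono (hdom k) (Nat.find_spec (hex k))
    simp only [id]
    rw [Option.mem_def.1 h]
    rfl

theorem stmt_8 : ∃ c : ℕ ≃ ℕ,
    Primrec (fun x => c (c.symm x + 1)) ∧
    ¬ Primrec (fun x => c.symm (Nat.pred (c x))) := by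
  obtain ⟨t, hle, hge, ht⟩ := exists_primrecRel_not_dominated
  let c : ℕ ≃ ℕ := Equiv.ofBijective _ (iterate_detourStep_bijective (t := t))
  have hc : ∀ n, c n = (detourStep t)^[n] 1 := fun _ => rfl
  refine ⟨c, (primrec_detourStep hle hge).of_eq fun x => ?_, fun hg => ?_⟩
  · rw [hc, Function.iterate_succ_apply', ← hc, Equiv.apply_symm_apply]
  · refine ht _ (hg.comp ((primrec_mainTime hle hge).comp
      (Primrec₂.natPair.comp Primrec.id (Primrec.const 0)))) fun k => ?_
    have hside : c.symm (2 * pair k 0) = mainTime t (pair k (t k)) + 1 := by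
      rw [Equiv.symm_apply_eq, hc, iterate_mainTime_add_one]
    simp only [id, hc, iterate_mainTime, Nat.pred_eq_sub_one, Nat.add_sub_cancel, hside]
    have h₁ := le_mainTime (t := t) (pair k (t k))
    have h₂ := right_le_pair k (t k)
    omega
end

section
/- There exist a bijection c : ℕ ≃ ℕ with c ∘ S ∘ c⁻¹ primitive recursive (where S x = x + 1) and a unary predicate R on ℕ such that R is primitive recursive but the predicate x ↦ R (c⁻¹ x) is not primitive recursive. -/
section PrimrecCodes

open Nat.Partrec (Code)
open Nat.Partrec.Code

/-- A code is `rfindFree` when it does not use unbounded search. -/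
def Nat.Partrec.Code.rfindFree (c : Code) : Bool :=
  Code.recOn c true true true true
    (fun _ _ a b => a && b) (fun _ _ a b => a && b) (fun _ _ a b => a && b) (fun _ _ => false)

theorem Nat.Partrec.Code.primrec_rfindFree : Primrec Code.rfindFree := by
  have h : Primrec fun a : Code × Code × Code × Bool × Bool => a.2.2.2.1 && a.2.2.2.2 :=
    Primrec.and.comp
      (Primrec.fst.comp (Primrec.snd.comp (Primrec.snd.comp Primrec.snd)))
      (Primrec.snd.comp (Primrec.snd.comp (Primrec.snd.comp Primrec.snd)))
  exact primrec_recOn (σ := Bool) _root_.Primrec.id (_root_.Primrec.const true) (_root_.Primrec.const true)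
    (_root_.Primrec.const true) (_root_.Primrec.const true)
    (pr := fun _ _ _ a b => a && b) h (co := fun _ _ _ a b => a && b) h
    (pc := fun _ _ _ a b => a && b) h (rf := fun _ _ _ => false) (_root_.Primrec.const false)

theorem Nat.Partrec.Code.eval_dom_of_rfindFree {c : Code} (hc : c.rfindFree = true) (n : ℕ) :
    (eval c n).Dom := by
  induction c generalizing n with
  | zero => trivial
  | succ => trivial
  | left => trivial
  | right => trivial
  | pair cf cg hf hg =>
    have hc' : cf.rfindFree = true ∧ cg.rfindFree = true := by
      simpa [Code.rfindFree] using hc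
    have h1 := Part.dom_iff_mem.1 (hf hc'.1 n)
    have h2 := Part.dom_iff_mem.1 (hg hc'.2 n)
    obtain ⟨x, hx⟩ := h1
    obtain ⟨y, hy⟩ := h2
    refine Part.dom_iff_mem.2 ⟨Nat.pair x y, ?_⟩
    simp only [eval, Seq.seq]
    simp [hx, hy]
  | comp cf cg hf hg =>
    have hc' : cf.rfindFree = true ∧ cg.rfindFree = true := by
      simpa [Code.rfindFree] using hc
    obtain ⟨y, hy⟩ := Part.dom_iff_mem.1 (hg hc'.2 n)
    obtain ⟨x, hx⟩ := Part.dom_iff_mem.1 (hf hc'.1 y)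
    exact Part.dom_iff_mem.2 ⟨x, Part.mem_bind hy hx⟩
  | prec cf cg hf hg =>
    have hc' : cf.rfindFree = true ∧ cg.rfindFree = true := by
      simpa [Code.rfindFree] using hc
    obtain ⟨a, k, rfl⟩ : ∃ a k, n = Nat.pair a k := ⟨_, _, (Nat.pair_unpair n).symm⟩
    induction k with
    | zero => rw [eval_prec_zero]; exact hf hc'.1 a
    | succ k ih =>
      rw [eval_prec_succ]
      obtain ⟨y, hy⟩ := Part.dom_iff_mem.1 ih
      obtain ⟨x, hx⟩ := Part.dom_iff_mem.1 (hg hc'.2 (Nat.pair a (Nat.pair k y)))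
      exact Part.dom_iff_mem.2 ⟨x, Part.mem_bind hy hx⟩
  | rfind' cf hf => simp [Code.rfindFree] at hc

theorem Nat.Primrec.exists_rfindFree_code {f : ℕ → ℕ} (hf : Nat.Primrec f) :
    ∃ c : Code, c.rfindFree = true ∧ ∀ n, f n ∈ eval c n := by
  induction hf with
  | zero => exact ⟨.zero, rfl, fun _ => Part.mem_some _⟩
  | succ => exact ⟨.succ, rfl, fun _ => Part.mem_some _⟩
  | left => exact ⟨.left, rfl, fun _ => Part.mem_some _⟩
  | right => exact ⟨.right, rfl, fun _ => Part.mem_some _⟩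
  | pair _ _ hf hg =>
    obtain ⟨cf, hf, ef⟩ := hf
    obtain ⟨cg, hg, eg⟩ := hg
    refine ⟨.pair cf cg, ?_, fun n => ?_⟩
    · simp only [Code.rfindFree] at hf hg ⊢
      simp [hf, hg]
    · simp only [eval, Seq.seq]
      simp [Part.eq_some_iff.2 (ef n), Part.eq_some_iff.2 (eg n)]
  | comp _ _ hf hg =>
    obtain ⟨cf, hf, ef⟩ := hf
    obtain ⟨cg, hg, eg⟩ := hg
    refine ⟨.comp cf cg, ?_, fun n => Part.mem_bind (eg n) (ef _)⟩
    simp only [Code.rfindFree] at hf hg ⊢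
    simp [hf, hg]
  | prec _ _ hf hg =>
    obtain ⟨cf, hf, ef⟩ := hf
    obtain ⟨cg, hg, eg⟩ := hg
    refine ⟨.prec cf cg, ?_, fun n => ?_⟩
    · simp only [Code.rfindFree] at hf hg ⊢
      simp [hf, hg]
    · obtain ⟨a, k, rfl⟩ : ∃ a k, n = Nat.pair a k := ⟨_, _, (Nat.pair_unpair n).symm⟩
      simp only [Nat.unpaired, Nat.unpair_pair]
      induction k with
      | zero => rw [eval_prec_zero]; exact ef a
      | succ k ih => rw [eval_prec_succ]; exact Part.mem_bind ih (eg _)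

/-- There is a computable set of naturals that is not primitive recursive. -/
theorem exists_computable_not_primrecPred :
    ∃ g : ℕ → ℕ, Computable g ∧ ¬ PrimrecPred fun n => g n = 0 := by
  classical
  let e : ℕ → ℕ →. ℕ := fun n k =>
    cond (Denumerable.ofNat Code n).rfindFree (eval (Denumerable.ofNat Code n) k) (Part.some 0)
  have hdom : ∀ n, (e n n).Dom := by
    intro n
    simp only [e]
    cases h : (Denumerable.ofNat Code n).rfindFree
    · trivial
    · exact eval_dom_of_rfindFree h n
  have he : Partrec fun n => e n n :=
    Partrec.cond ((primrec_rfindFree.comp (Primrec.ofNat Code)).to_comp)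
      (eval_part.comp (Primrec.ofNat Code).to_comp Computable.id) (Computable.const 0)
  refine ⟨fun n => (e n n).get (hdom n), he.of_eq_tot fun n => Part.get_mem _, fun h => ?_⟩
  have hprim : Primrec fun n => if (e n n).get (hdom n) = 0 then 1 else 0 :=
    Primrec.ite h (Primrec.const 1) (Primrec.const 0)
  obtain ⟨c, hc, hmem⟩ := (Primrec.nat_iff.1 hprim).exists_rfindFree_code
  have h1 := hmem (Encodable.encode c)
  have h2 := Part.get_mem (hdom (Encodable.encode c))
  have h3 : e (Encodable.encode c) (Encodable.encode c) = eval c (Encodable.encode c) := by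
    simp [e, hc]
  rw [← h3] at h1
  have h4 := Part.mem_unique h1 h2
  split_ifs at h4 <;> omega

end PrimrecCodes

section Chain

/-- The grid point `(k, i)` is *late* when the search in row `k` ended at least two steps
before `i`. -/
def Late (halt : ℕ → ℕ → Bool) (x : ℕ × ℕ) : Prop :=
  2 ≤ x.2 ∧ halt x.1 (x.2 - 2) = true

instance (halt : ℕ → ℕ → Bool) : DecidablePred (Late halt) :=
  fun _ => inferInstanceAs (Decidable (_ ∧ _))

/-- The successor on `ℕ × ℕ` that walks through each row until its search ends, then passes to the
next row. The late point `unpair k` is visited between `(k, 0)` and `(k, 1)`. -/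
def chainSucc (halt : ℕ → ℕ → Bool) (x : ℕ × ℕ) : ℕ × ℕ :=
  if Late halt x then (Nat.pair x.1 x.2, 1)
  else if x.2 = 0 ∧ Late halt (Nat.unpair x.1) then Nat.unpair x.1
  else if Late halt (x.1, x.2 + 1) then (x.1 + 1, 0)
  else (x.1, x.2 + 1)

variable {halt : ℕ → ℕ → Bool}

theorem Late.mono (hmono : ∀ k, Monotone (halt k)) {k i j : ℕ} (hij : i ≤ j)
    (h : Late halt (k, i)) : Late halt (k, j) := by
  obtain ⟨h1, h2⟩ := h
  exact ⟨h1.trans hij, hmono k (Nat.sub_le_sub_right hij 2) h2⟩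

theorem not_late_of_lt {k i : ℕ} (h : i < 2) : ¬ Late halt (k, i) := fun h' => by
  have : 2 ≤ i := h'.1
  omega

theorem chainSucc_of_late {x : ℕ × ℕ} (h : Late halt x) :
    chainSucc halt x = (Nat.pair x.1 x.2, 1) := by
  simp [chainSucc, h]

theorem primrec_chainSucc (h : Primrec₂ halt) : Primrec (chainSucc halt) := by
  have hL : PrimrecPred (Late halt) := by
    refine PrimrecPred.and
      (Primrec.nat_le.comp (Primrec.const 2) Primrec.snd)
      (Primrec.eq.comp (h.comp Primrec.fst (Primrec.nat_sub.comp Primrec.snd (Primrec.const 2)))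
        (Primrec.const true))
  have hu : Primrec fun x : ℕ × ℕ => Nat.unpair x.1 := Primrec.unpair.comp Primrec.fst
  have hs : Primrec fun x : ℕ × ℕ => (x.1, x.2 + 1) :=
    Primrec.fst.pair (Primrec.succ.comp Primrec.snd)
  refine Primrec.ite hL
    ((Primrec₂.natPair.comp Primrec.fst Primrec.snd).pair (Primrec.const 1)) ?_
  refine Primrec.ite ((Primrec.eq.comp Primrec.snd (Primrec.const 0)).and (hL.comp hu)) hu ?_
  exact Primrec.ite (hL.comp hs) ((Primrec.succ.comp Primrec.fst).pair (Primrec.const 0)) hs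

theorem chainSucc_ne_zero (x : ℕ × ℕ) : chainSucc halt x ≠ (0, 0) := by
  intro h
  unfold chainSucc at h
  split_ifs at h with h1 h2 h3
  · simp at h
  · rw [h] at h2
    exact not_late_of_lt (by norm_num) h2.2
  · simp at h
  · simp at h

theorem chainSucc_injective (hmono : ∀ k, Monotone (halt k)) :
    Function.Injective (chainSucc halt) := by
  rintro ⟨k, i⟩ ⟨l, j⟩ h
  have hrow : ∀ {k i j : ℕ}, ¬ Late halt (k, i) → Late halt (k, j + 1) → i ≤ j := by
    intro k i j h1 h2
    by_contra! hlt
    exact h1 (h2.mono hmono hlt)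
  simp only [chainSucc] at h
  split_ifs at h with a1 b1 b2 b3 a2 b1 b2 b3 a3 b1 b2 b3 b1 b2 b3
  · simpa [Nat.pair_eq_pair] using h
  · rw [← h] at b2
    exact absurd b2.2 (not_late_of_lt (by norm_num))
  · simp at h
  · simp only [Prod.mk.injEq] at h
    obtain ⟨h1, h2⟩ := h
    refine absurd ⟨by omega, ?_⟩ b2
    rw [← h1, Nat.unpair_pair]
    exact a1
  · rw [h] at a2
    exact absurd a2.2 (not_late_of_lt (by norm_num))
  · have : k = l := by rw [← Nat.pair_unpair k, h, Nat.pair_unpair]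
    simp_all
  · rw [h] at a2
    exact absurd a2.2 (not_late_of_lt (by norm_num))
  · rw [h] at a2
    exact absurd a2.2 b3
  · simp at h
  · rw [← h] at b2
    exact absurd b2.2 (not_late_of_lt (by norm_num))
  · simp only [Prod.mk.injEq, and_true] at h
    obtain rfl : k = l := by omega
    rw [le_antisymm (hrow a1 b3) (hrow b1 a3)]
  · simp at h
  · simp only [Prod.mk.injEq] at h
    obtain ⟨h1, h2⟩ := h
    refine absurd ⟨by omega, ?_⟩ a2
    rw [h1, Nat.unpair_pair]
    exact b1
  · rw [← h] at b2
    exact absurd b2.2 a3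
  · simp at h
  · simpa using h

theorem chainSucc_iterate_injective (hmono : ∀ k, Monotone (halt k)) :
    Function.Injective fun n => (chainSucc halt)^[n] (0, 0) := by
  intro a b h
  dsimp only at h
  wlog hab : a ≤ b generalizing a b
  · exact (this h.symm (by omega)).symm
  obtain ⟨d, rfl⟩ := Nat.exists_eq_add_of_le hab
  rw [Function.iterate_add_apply] at h
  have h' := (chainSucc_injective hmono).iterate a h
  cases d with
  | zero => rfl
  | succ d =>
    rw [Function.iterate_succ_apply'] at h'
    exact absurd h'.symm (chainSucc_ne_zero _)

theorem chainSucc_iterate_surjective (hmono : ∀ k, Monotone (halt k))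
    (htot : ∀ k, ∃ t, halt k t = true) :
    Function.Surjective fun n => (chainSucc halt)^[n] (0, 0) := by
  have step : ∀ {x : ℕ × ℕ} (y : ℕ × ℕ), (∃ n, (chainSucc halt)^[n] (0, 0) = x) →
      chainSucc halt x = y → ∃ n, (chainSucc halt)^[n] (0, 0) = y := by
    rintro x y ⟨n, rfl⟩ rfl
    exact ⟨n + 1, Function.iterate_succ_apply' _ _ _⟩
  have late : ∀ {k i : ℕ}, (∃ n, (chainSucc halt)^[n] (0, 0) = (Nat.pair k i, 0)) →
      Late halt (k, i) → ∃ n, (chainSucc halt)^[n] (0, 0) = (k, i) := by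
    intro k i h hl
    refine step _ h ?_
    have : ¬ Late halt (Nat.pair k i, 0) := not_late_of_lt (by norm_num)
    simp [chainSucc, this, hl]
  have row : ∀ {k : ℕ}, (∃ n, (chainSucc halt)^[n] (0, 0) = (k, 0)) →
      ∀ i, ¬ Late halt (k, i) → ∃ n, (chainSucc halt)^[n] (0, 0) = (k, i) := by
    intro k h i
    induction i with
    | zero => exact fun _ => h
    | succ i ih =>
      intro h1
      have h3 : ¬ Late halt (k, i) := fun hl => h1 (hl.mono hmono i.le_succ)
      by_cases hc : i = 0 ∧ Late halt (Nat.unpair k)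
      · obtain ⟨rfl, hc⟩ := hc
        have hk : ∃ n, (chainSucc halt)^[n] (0, 0) = Nat.unpair k :=
          late (k := k.unpair.1) (i := k.unpair.2) (by rwa [Nat.pair_unpair]) hc
        refine step _ hk ?_
        rw [chainSucc_of_late hc, Nat.pair_unpair]
      · refine step _ (ih h3) ?_
        simp only [chainSucc]
        rw [if_neg h3, if_neg hc, if_neg h1]
  have start : ∀ k, ∃ n, (chainSucc halt)^[n] (0, 0) = (k, 0) := by
    intro k
    induction k with
    | zero => exact ⟨0, rfl⟩
    | succ k ih =>
      have hex : ∃ i, Late halt (k, i) := by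
        obtain ⟨t, ht⟩ := htot k
        exact ⟨t + 2, by simp, by simpa using ht⟩
      have hfind := Nat.find_spec hex
      have hge : 2 ≤ Nat.find hex := hfind.1
      obtain ⟨j, hj⟩ : ∃ j, Nat.find hex = j + 1 := ⟨Nat.find hex - 1, by omega⟩
      have hmin : ¬ Late halt (k, j) := Nat.find_min hex (by omega)
      rw [hj] at hfind
      refine step _ (row ih j hmin) ?_
      simp only [chainSucc]
      rw [if_neg hmin, if_neg (by omega), if_pos hfind]
  rintro ⟨k, i⟩
  by_cases hl : Late halt (k, i)
  · exact late (start _) hl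
  · exact row (start k) i hl

theorem snd_chainSucc_iterate_le (n : ℕ) (h : ¬ Late halt ((chainSucc halt)^[n] (0, 0))) :
    ((chainSucc halt)^[n] (0, 0)).2 ≤ n := by
  induction n with
  | zero => simp
  | succ n ih =>
    rw [Function.iterate_succ_apply'] at h ⊢
    generalize (chainSucc halt)^[n] (0, 0) = x at h ih
    unfold chainSucc at h ⊢
    split_ifs at h ⊢ with h1 h2 h3
    · simp
    · exact absurd h2.2 h
    · simp
    · simpa using ih h1

theorem halt_of_chainSucc_iterate_eq (hmono : ∀ k, Monotone (halt k)) {n k : ℕ}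
    (h : (chainSucc halt)^[n] (0, 0) = (k + 1, 0)) : halt k n = true := by
  cases n with
  | zero => simp at h
  | succ n =>
    have hle := snd_chainSucc_iterate_le (halt := halt) n
    rw [Function.iterate_succ_apply'] at h
    generalize (chainSucc halt)^[n] (0, 0) = x at h hle
    unfold chainSucc at h
    split_ifs at h with h1 h2 h3
    · simp at h
    · rw [h] at h2
      exact absurd h2.2 (not_late_of_lt (by norm_num))
    · simp only [Prod.mk.injEq, add_left_inj, and_true] at h
      subst h
      have := hle h1
      exact hmono _ (by simp only; omega) h3.2
    · simp at h

end Chain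

theorem stmt_9 : ∃ (c : ℕ ≃ ℕ) (R : ℕ → Prop) (_ : DecidablePred R),
    Primrec (fun x => c (c.symm x + 1)) ∧
    PrimrecPred R ∧
    ¬ PrimrecPred (fun x => R (c.symm x)) := by
  obtain ⟨g, hg, hng⟩ := exists_computable_not_primrecPred
  obtain ⟨p, hp⟩ := Nat.Partrec.Code.exists_code.1 (Partrec.nat_iff.1 hg)
  have hval : ∀ {t k x}, x ∈ Nat.Partrec.Code.evaln t p k → x = g k := by
    intro t k x hx
    have := Nat.Partrec.Code.evaln_sound hx
    rw [hp] at this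
    exact Part.mem_some_iff.1 this
  let halt : ℕ → ℕ → Bool := fun k t => (Nat.Partrec.Code.evaln t p k).isSome
  have hmono : ∀ k, Monotone (halt k) := by
    intro k s t hst hs
    obtain ⟨x, hx⟩ := Option.isSome_iff_exists.1 hs
    exact Option.isSome_iff_exists.2 ⟨x, Nat.Partrec.Code.evaln_mono hst hx⟩
  have htot : ∀ k, ∃ t, halt k t = true := by
    intro k
    have : g k ∈ Nat.Partrec.Code.eval p k := by
      rw [hp]
      exact Part.mem_some _
    obtain ⟨t, ht⟩ := Nat.Partrec.Code.evaln_complete.1 this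
    exact ⟨t, Option.isSome_iff_exists.2 ⟨_, ht⟩⟩
  have heval : Primrec₂ fun k t => Nat.Partrec.Code.evaln t p k :=
    Nat.Partrec.Code.primrec_evaln.comp
      ((Primrec.snd.pair (Primrec.const p)).pair Primrec.fst)
  have hhalt : Primrec₂ halt := Primrec.option_isSome.comp heval
  have hsucc := primrec_chainSucc hhalt
  let e : ℕ ≃ ℕ × ℕ := Equiv.ofBijective (fun n => (chainSucc halt)^[n] (0, 0))
    ⟨chainSucc_iterate_injective hmono, chainSucc_iterate_surjective hmono htot⟩
  have he : ∀ n, e n = (chainSucc halt)^[n] (0, 0) := fun _ => rfl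
  have he_prim : Primrec e :=
    Primrec.nat_iterate Primrec.id (Primrec.const (0, 0)) (hsucc.comp Primrec.snd).to₂
  refine ⟨e.trans Nat.pairEquiv,
    fun n => Nat.Partrec.Code.evaln n p ((e n).1 - 1) = some 0, inferInstance, ?_, ?_, ?_⟩
  · refine ((Primrec₂.natPair.comp Primrec.fst Primrec.snd).comp
      (hsucc.comp Primrec.unpair)).of_eq fun x => ?_
    have : e (e.symm (Nat.unpair x) + 1) = chainSucc halt (Nat.unpair x) := by
      rw [he, Function.iterate_succ_apply', ← he, Equiv.apply_symm_apply]
    simp [this, Function.uncurry]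
  · exact Primrec.eq.comp
      (heval.comp (Primrec.nat_sub.comp (Primrec.fst.comp he_prim) (Primrec.const 1)) Primrec.id)
      (Primrec.const (some 0))
  · intro h
    refine hng ((h.comp (Primrec₂.natPair.comp Primrec.succ (Primrec.const 0))).of_eq fun k => ?_)
    have h1 : e (e.symm (k + 1, 0)) = (k + 1, 0) := e.apply_symm_apply _
    have h2 : halt k (e.symm (k + 1, 0)) = true := halt_of_chainSucc_iterate_eq hmono h1
    obtain ⟨x, hx⟩ := Option.isSome_iff_exists.1 h2
    simp [hx, hval hx]
end

section
/- Let c : ℕ ≃ ℕ be a bijection with c ∘ S ∘ c⁻¹ primitive recursive (where S x = x + 1), and let d : ℕ ≃ ℕ be a bijection satisfying: for all n, i ∈ ℕ, the i-th binary bit of d n equals the (c⁻¹ i)-th binary bit of n. Then both the function d ∘ S ∘ d⁻¹ and the binary function (x, y) ↦ d (d⁻¹ x + d⁻¹ y) are primitive recursive. -/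
namespace PositionalAddition

/-- One step of binary addition of `2 ^ i` to `x`, when the successor of position `i` is `f i`:
if position `i` is occupied, clear it and carry to position `f i`. -/
def carryStep (f : ℕ → ℕ) (p : ℕ × ℕ) : ℕ × ℕ :=
  if p.1.testBit p.2 = true then (p.1 - 2 ^ p.2, f p.2) else p

/-- Add the digit at position `i` to `x`, when the successor of a position is given by `f`. -/
def carryAdd (f : ℕ → ℕ) (x i : ℕ) : ℕ :=
  ((carryStep f)^[x] (x, i)).1 + 2 ^ ((carryStep f)^[x] (x, i)).2

/-- Add to `x` the digits of `y` at positions below `k`. -/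
def carryAddBelow (f : ℕ → ℕ) (x y k : ℕ) : ℕ :=
  Nat.rec x (fun i acc => if y.testBit i = true then carryAdd f acc i else acc) k

theorem primrec₂_pow : Primrec₂ ((· ^ ·) : ℕ → ℕ → ℕ) :=
  Primrec₂.unpaired'.1 Nat.Primrec.pow

theorem primrecRel_testBit : PrimrecRel fun x i : ℕ => x.testBit i = true := by
  have h : PrimrecRel fun x i : ℕ => x / 2 ^ i % 2 = 1 :=
    Primrec.eq.comp₂
      (Primrec.nat_mod.comp₂
        (Primrec.nat_div.comp₂ Primrec₂.left
          (primrec₂_pow.comp₂ (Primrec₂.const 2) Primrec₂.right))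
        (Primrec₂.const 2))
      (Primrec₂.const 1)
  exact h.of_eq fun x i => by simp [Nat.testBit_eq_decide_div_mod_eq]

theorem primrec_carryStep {f : ℕ → ℕ} (hf : Primrec f) : Primrec (carryStep f) :=
  Primrec.ite (primrecRel_testBit.comp Primrec.fst Primrec.snd)
    (Primrec.pair
      (Primrec.nat_sub.comp Primrec.fst (primrec₂_pow.comp (Primrec.const 2) Primrec.snd))
      (hf.comp Primrec.snd))
    Primrec.id

theorem primrec₂_carryAdd {f : ℕ → ℕ} (hf : Primrec f) : Primrec₂ (carryAdd f) := by
  have h : Primrec fun p : ℕ × ℕ => (carryStep f)^[p.1] p :=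
    Primrec.nat_iterate Primrec.fst Primrec.id ((primrec_carryStep hf).comp Primrec.snd).to₂
  exact Primrec.nat_add.comp (Primrec.fst.comp h)
    (primrec₂_pow.comp (Primrec.const 2) (Primrec.snd.comp h))

theorem primrec₂_carryAddBelow {f : ℕ → ℕ} (hf : Primrec f) :
    Primrec₂ fun x y => carryAddBelow f x y y := by
  refine Primrec.nat_rec' (f := fun p : ℕ × ℕ => p.2) (g := fun p => p.1)
    (h := fun p q => if p.2.testBit q.1 = true then carryAdd f q.2 q.1 else q.2)
    Primrec.snd Primrec.fst ?_
  have hi : Primrec fun r : (ℕ × ℕ) × ℕ × ℕ => r.2.1 := Primrec.fst.comp Primrec.snd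
  have hacc : Primrec fun r : (ℕ × ℕ) × ℕ × ℕ => r.2.2 := Primrec.snd.comp Primrec.snd
  exact Primrec.ite
    (primrecRel_testBit.comp (Primrec.snd.comp Primrec.fst) hi)
    ((primrec₂_carryAdd hf).comp hacc hi) hacc

theorem testBit_iterate_carryStep (f : ℕ → ℕ) (n : ℕ) (p : ℕ × ℕ) (h : p.1 ≤ n) :
    ((carryStep f)^[n] p).1.testBit ((carryStep f)^[n] p).2 = false := by
  induction n generalizing p with
  | zero => simp [Nat.le_zero.1 h]
  | succ n ih =>
    rw [Function.iterate_succ_apply]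
    by_cases hp : p.1.testBit p.2 = true
    · refine ih _ ?_
      have := Nat.two_pow_pos p.2
      simp only [carryStep, hp, if_true]
      omega
    · have hfix : carryStep f p = p := by simp [carryStep, hp]
      rw [hfix, Function.iterate_fixed hfix]
      simpa using hp

theorem mod_two_pow_succ (x i : ℕ) :
    x % 2 ^ (i + 1) = x % 2 ^ i + 2 ^ i * (x.testBit i).toNat := by
  rw [Nat.mod_pow_succ, Nat.toNat_testBit]

theorem testBit_add_two_pow {x i : ℕ} (h : x.testBit i = false) (j : ℕ) :
    (x + 2 ^ i).testBit j = (x.testBit j || decide (i = j)) := by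
  rw [Nat.add_comm]
  rcases lt_trichotomy j i with hji | rfl | hij
  · rw [Nat.testBit_two_pow_add_gt hji]
    simp [hji.ne']
  · simp [Nat.testBit_two_pow_add_eq, h]
  · have hlt : x % 2 ^ (i + 1) < 2 ^ i := by
      rw [mod_two_pow_succ, h]
      simpa using Nat.mod_lt x (Nat.two_pow_pos i)
    have hdiv : (2 ^ i + x) / 2 ^ (i + 1) = x / 2 ^ (i + 1) := by
      have hx := Nat.div_add_mod x (2 ^ (i + 1))
      have hpow : 2 ^ (i + 1) = 2 * 2 ^ i := by ring
      refine Nat.div_eq_of_lt_le ?_ ?_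
      · exact (Nat.div_mul_le_self x _).trans (Nat.le_add_left _ _)
      · rw [Nat.add_mul]
        linarith [Nat.mul_comm (2 ^ (i + 1)) (x / 2 ^ (i + 1))]
    obtain ⟨k, rfl⟩ := Nat.exists_eq_add_of_lt hij
    have hk : i + k + 1 = k + (i + 1) := by omega
    rw [hk, ← Nat.testBit_div_two_pow, hdiv, Nat.testBit_div_two_pow]
    simp [show i ≠ k + (i + 1) by omega]

section Digits

variable {c e : ℕ ≃ ℕ} (he : ∀ n j : ℕ, (e n).testBit j = n.testBit (c j))
include he

theorem apply_add_two_pow_of_testBit {x i : ℕ} (h : x.testBit i = false) :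
    e (x + 2 ^ i) = e x + 2 ^ c.symm i := by
  have h' : (e x).testBit (c.symm i) = false := by simpa [he] using h
  refine Nat.eq_of_testBit_eq fun j => ?_
  rw [he, testBit_add_two_pow h, testBit_add_two_pow h', he]
  simp [Equiv.symm_apply_eq]

theorem apply_add_carryStep {f : ℕ → ℕ} (hf : ∀ i, c.symm (f i) = c.symm i + 1) (p : ℕ × ℕ) :
    e (carryStep f p).1 + 2 ^ c.symm (carryStep f p).2 = e p.1 + 2 ^ c.symm p.2 := by
  obtain ⟨x, i⟩ := p
  by_cases h : x.testBit i = true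
  · obtain ⟨y, rfl⟩ := Nat.exists_eq_add_of_le (Nat.ge_two_pow_of_testBit h)
    have hy : y.testBit i = false := by simpa [Nat.testBit_two_pow_add_eq] using h
    simp only [carryStep, h, if_true, Nat.add_sub_cancel_left, hf]
    rw [Nat.add_comm (2 ^ i) y, apply_add_two_pow_of_testBit he hy]
    ring
  · simp [carryStep, h]

theorem apply_carryAdd {f : ℕ → ℕ} (hf : ∀ i, c.symm (f i) = c.symm i + 1) (x i : ℕ) :
    e (carryAdd f x i) = e x + 2 ^ c.symm i := by
  have hiter (n : ℕ) (p : ℕ × ℕ) :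
      e ((carryStep f)^[n] p).1 + 2 ^ c.symm ((carryStep f)^[n] p).2 =
        e p.1 + 2 ^ c.symm p.2 := by
    induction n generalizing p with
    | zero => rfl
    | succ n ih => rw [Function.iterate_succ_apply, ih, apply_add_carryStep he hf]
  rw [carryAdd,
    apply_add_two_pow_of_testBit he (testBit_iterate_carryStep f x (x, i) le_rfl), hiter]

theorem apply_carryAddBelow {f : ℕ → ℕ} (hf : ∀ i, c.symm (f i) = c.symm i + 1) (x y k : ℕ) :
    e (carryAddBelow f x y k) = e x + e (y % 2 ^ k) := by
  have hzero : e 0 = 0 := Nat.eq_of_testBit_eq fun j => by simp [he]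
  induction k with
  | zero => simp [carryAddBelow, Nat.mod_one, hzero]
  | succ k ih =>
    have hstep : carryAddBelow f x y (k + 1) =
        if y.testBit k = true then carryAdd f (carryAddBelow f x y k) k
        else carryAddBelow f x y k := rfl
    rw [hstep, mod_two_pow_succ]
    by_cases h : y.testBit k = true
    · have hk : (y % 2 ^ k).testBit k = false := by simp
      simp only [h, if_true, Bool.toNat_true, Nat.mul_one]
      rw [apply_carryAdd he hf, ih, apply_add_two_pow_of_testBit he hk, Nat.add_assoc]
    · simp [h, ih]

theorem apply_carryAddBelow_self {f : ℕ → ℕ} (hf : ∀ i, c.symm (f i) = c.symm i + 1)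
    (x y : ℕ) : e (carryAddBelow f x y y) = e x + e y := by
  rw [apply_carryAddBelow he hf, Nat.mod_eq_of_lt Nat.lt_two_pow_self]

end Digits

end PositionalAddition

theorem stmt_10 (c d : ℕ ≃ ℕ)
    (hS : Primrec fun x => c (c.symm x + 1))
    (hd : ∀ n i : ℕ, Nat.testBit (d n) i = Nat.testBit n (c.symm i)) :
    Primrec (fun x => d (d.symm x + 1)) ∧
    Primrec₂ (fun x y : ℕ => d (d.symm x + d.symm y)) := by
  have he (n j : ℕ) : (d.symm n).testBit j = n.testBit (c j) := by
    simpa using (hd (d.symm n) (c j)).symm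
  have hadd : Primrec₂ fun x y : ℕ => d (d.symm x + d.symm y) :=
    (PositionalAddition.primrec₂_carryAddBelow hS).of_eq fun x y => by
      rw [← PositionalAddition.apply_carryAddBelow_self he (fun i => c.symm_apply_apply _) x y,
        d.apply_symm_apply]
  refine ⟨?_, hadd⟩
  exact (hadd.comp Primrec.id (Primrec.const (d 1))).of_eq fun x => by simp
end

section
/- Let c : ℕ ≃ ℕ be a bijection with c ∘ S ∘ c⁻¹ primitive recursive (where S x = x + 1), and let d : ℕ ≃ ℕ be a bijection satisfying: for all n, i ∈ ℕ, the i-th binary bit of d n equals the (c⁻¹ i)-th binary bit of n. Then the binary function (x, u) ↦ d (d⁻¹ x + 2 ^ (c⁻¹ u)) is primitive recursive. -/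
theorem Nat.add_two_pow_eq_lor {n k : ℕ} (h : n.testBit k = false) : n + 2 ^ k = n ||| 2 ^ k := by
  induction k generalizing n with
  | zero =>
    have hn : n % 2 = 0 := by simpa [Nat.testBit_zero] using h
    obtain ⟨m, rfl⟩ := Nat.dvd_of_mod_eq_zero hn
    simpa using Nat.two_pow_add_eq_or_of_lt (i := 1) (b := 1) (by decide) m
  | succ k ih =>
    have hdiv := ih (n := n / 2) (by rwa [← Nat.testBit_succ])
    have hmod : (n ||| 2 ^ (k + 1)) % 2 = n % 2 := by
      simp [Nat.or_mod_two_pow (n := 1), pow_succ]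
    have hdiv' : (n ||| 2 ^ (k + 1)) / 2 = n / 2 ||| 2 ^ k := by
      rw [Nat.or_div_two, pow_succ, Nat.mul_div_cancel _ two_pos]
    omega

theorem Nat.testBit_sub_two_pow_self {n k : ℕ} (h : n.testBit k = true) :
    (n - 2 ^ k).testBit k = false := by
  have hle := Nat.ge_two_pow_of_testBit h
  have := Nat.testBit_two_pow_add_eq (n - 2 ^ k) k
  rw [Nat.add_sub_cancel' hle, h] at this
  simpa using this.symm

theorem Primrec.nat_testBit : Primrec₂ Nat.testBit := by
  have h : PrimrecRel fun n k : ℕ => n / 2 ^ k % 2 = 1 :=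
    Primrec.eq.comp
      (Primrec.nat_mod.comp
        (Primrec.nat_div.comp .fst (Primrec.nat_pow.comp (.const 2) .snd)) (.const 2))
      (.const 1)
  exact h.decide.of_eq fun n k => Nat.testBit_eq_decide_div_mod_eq.symm

/-- One step of the carry propagation in `x + 2 ^ u` on a pair `(x, u)`, the successor of a
position being given by `s`. -/
def carryStep (s : ℕ → ℕ) (p : ℕ × ℕ) : ℕ × ℕ :=
  bif p.1.testBit p.2 then (p.1 - 2 ^ p.2, s p.2) else p

theorem Primrec.carryStep {s : ℕ → ℕ} (hs : Primrec s) : Primrec (carryStep s) :=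
  Primrec.cond (Primrec.nat_testBit.comp .fst .snd)
    (Primrec.pair
      (Primrec.nat_sub.comp .fst (Primrec.nat_pow.comp (.const 2) .snd))
      (hs.comp .snd))
    .id

theorem permBits_add_of_testBit_eq_false {c d : ℕ ≃ ℕ}
    (hd : ∀ n i : ℕ, Nat.testBit (d n) i = Nat.testBit n (c.symm i))
    {x u : ℕ} (h : x.testBit u = false) :
    d (d.symm x + 2 ^ c.symm u) = x + 2 ^ u := by
  have h' : (d.symm x).testBit (c.symm u) = false := by
    rw [← hd, Equiv.apply_symm_apply, h]
  rw [Nat.add_two_pow_eq_lor h, Nat.add_two_pow_eq_lor h']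
  refine Nat.eq_of_testBit_eq fun i => ?_
  rw [hd, Nat.testBit_or, Nat.testBit_or, ← hd, Equiv.apply_symm_apply, Nat.testBit_two_pow,
    Nat.testBit_two_pow]
  simp

theorem permBits_add_of_testBit_eq_true {c d : ℕ ≃ ℕ}
    (hd : ∀ n i : ℕ, Nat.testBit (d n) i = Nat.testBit n (c.symm i))
    {x u : ℕ} (h : x.testBit u = true) :
    d (d.symm x + 2 ^ c.symm u) =
      d (d.symm (x - 2 ^ u) + 2 ^ c.symm (c (c.symm u + 1))) := by
  have key := permBits_add_of_testBit_eq_false hd (Nat.testBit_sub_two_pow_self h)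
  rw [Nat.sub_add_cancel (Nat.ge_two_pow_of_testBit h), ← Equiv.eq_symm_apply] at key
  rw [← key, Equiv.symm_apply_apply, pow_succ]
  congr 1
  ring

theorem permBits_add_eq_iterate_carryStep {c d : ℕ ≃ ℕ}
    (hd : ∀ n i : ℕ, Nat.testBit (d n) i = Nat.testBit n (c.symm i))
    (n : ℕ) (p : ℕ × ℕ) (hn : p.1 ≤ n) :
    d (d.symm p.1 + 2 ^ c.symm p.2) =
      ((carryStep fun u => c (c.symm u + 1))^[n] p).1 +
        2 ^ ((carryStep fun u => c (c.symm u + 1))^[n] p).2 := by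
  induction n generalizing p with
  | zero =>
    have h : p.1.testBit p.2 = false := by simp [Nat.le_zero.1 hn]
    exact permBits_add_of_testBit_eq_false hd h
  | succ n ih =>
    cases h : p.1.testBit p.2 with
    | false =>
      rw [Function.iterate_fixed (by simp [carryStep, h])]
      exact permBits_add_of_testBit_eq_false hd h
    | true =>
      have hpos := Nat.two_pow_pos p.2
      rw [Function.iterate_succ_apply, carryStep, h, cond_true, ← ih _ (by simp only; omega)]
      exact permBits_add_of_testBit_eq_true hd h

theorem stmt_11 (c d : ℕ ≃ ℕ)
    (hS : Primrec fun x => c (c.symm x + 1))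
    (hd : ∀ n i : ℕ, Nat.testBit (d n) i = Nat.testBit n (c.symm i)) :
    Primrec₂ (fun x u : ℕ => d (d.symm x + 2 ^ (c.symm u))) := by
  have hiter : Primrec fun q : ℕ × ℕ => (carryStep fun u => c (c.symm u + 1))^[q.1] q :=
    Primrec.nat_iterate .fst .id ((Primrec.carryStep hS).comp .snd)
  exact (Primrec.nat_add.comp (Primrec.fst.comp hiter)
    (Primrec.nat_pow.comp (.const 2) (Primrec.snd.comp hiter))).of_eq
      fun q => (permBits_add_eq_iterate_carryStep hd q.1 q le_rfl).symm
end
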